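/- arXiv:1109.6803 — 7 statements merged into one kernel-verified Lean document; each statement's English description precedes it below -/
import Mathlib

section
/- Let d = r + p + t with r, p, t ≥ 0 and let f : (ℂ^d, 0) → (ℂ^d, 0) be a contracting holomorphic germ which, in coordinates (u, y, w) ∈ ℂ^r × ℂ^p × ℂ^t, has the form f(u, y, w) = (α u^B (1 + θ(u,y,w)), β u^C y^D (1 + g(u,y,w)), k(u,y,w)), where α ∈ (ℂ*)^r, β ∈ (ℂ*)^p, B is an r×r permutation matrix, C ∈ M_{r×p}(ℕ), D ∈ M_{p×p}(ℕ), and θ : (ℂ^d,0) → (ℂ^r,0), g : (ℂ^d,0) → (ℂ^p,0), k : (ℂ^d,0) → (ℂ^t,0) are holomorphic germs vanishing at 0. Then f is holomorphically conjugated to a germ of the form f̃(u, y, w) = (α u^B, β u^C y^D (1 + g̃(u,y,w)), k̃(u,y,w)) for some holomorphic germs g̃ : (ℂ^d,0) → (ℂ^p,0) and k̃ : (ℂ^d,0) → (ℂ^t,0). -/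
noncomputable section

/-- `ℂ^r × ℂ^p × ℂ^t`. -/
abbrev Sp (a b c : ℕ) : Type := (Fin a → ℂ) × (Fin b → ℂ) × (Fin c → ℂ)

open scoped ENNReal NNReal in
theorem aux_tsum_pi (a : ℕ → ℝ≥0∞) (k : ℕ) :
    ∑' f : Fin k → ℕ, ∏ i, a (f i) = (∑' n, a n) ^ k := by
  induction k with
  | zero => simp
  | succ k ih =>
    rw [← (Fin.consEquiv (fun _ : Fin (k+1) => ℕ)).tsum_eq, ENNReal.tsum_prod', pow_succ']
    simp only [Fin.consEquiv, Equiv.coe_fn_mk, Fin.prod_univ_succ, Fin.cons_zero, Fin.cons_succ,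
      ENNReal.tsum_mul_left]
    rw [ih, ENNReal.tsum_mul_right]

open scoped ENNReal NNReal in
noncomputable def serN {E F : Type*} [NormedAddCommGroup E] [NormedSpace ℂ E] [NormedAddCommGroup F]
    [NormedSpace ℂ F] (q : FormalMultilinearSeries ℂ E F) (R : ℝ≥0∞) : ℝ≥0∞ :=
  ∑' n, (‖q n‖₊ : ℝ≥0∞) * R ^ n

open scoped ENNReal NNReal in
theorem serN_comp {E F G : Type*} [NormedAddCommGroup E] [NormedSpace ℂ E] [NormedAddCommGroup F]
    [NormedSpace ℂ F] [NormedAddCommGroup G]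
    [NormedSpace ℂ G] (q : FormalMultilinearSeries ℂ F G) (p : FormalMultilinearSeries ℂ E F)
    (R : ℝ≥0∞) : serN (q.comp p) R ≤ serN q (serN p R) := by
  have h1 : serN (q.comp p) R ≤ ∑' i : (Σ n, Composition n),
      (‖q i.2.length‖₊ : ℝ≥0∞) * ∏ j, ((‖p (i.2.blocksFun j)‖₊ : ℝ≥0∞) * R ^ (i.2.blocksFun j)) := by
    rw [ENNReal.tsum_sigma']
    refine ENNReal.tsum_le_tsum fun n => ?_
    rw [tsum_fintype]
    have : ∀ c : Composition n, (‖q c.length‖₊ : ℝ≥0∞) *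
        ∏ j, ((‖p (c.blocksFun j)‖₊ : ℝ≥0∞) * R ^ (c.blocksFun j))
        = ((‖q c.length‖₊ * ∏ i, ‖p (c.blocksFun i)‖₊ : ℝ≥0) : ℝ≥0∞) * R ^ n := by
      intro c
      rw [Finset.prod_mul_distrib, Finset.prod_pow_eq_pow_sum, c.sum_blocksFun]
      push_cast
      ring
    simp only [this]
    rw [← Finset.sum_mul]
    gcongr
    rw [← ENNReal.ofNNReal_finsetSum, ENNReal.coe_le_coe]
    refine (nnnorm_sum_le _ _).trans ?_
    exact Finset.sum_le_sum fun c _ => q.compAlongComposition_nnnorm p c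
  refine h1.trans ?_
  have hinj : Function.Injective (fun i : (Σ n, Composition n) =>
      (⟨i.2.length, i.2.blocksFun⟩ : Σ k, Fin k → ℕ)) := by
    rintro ⟨n, c⟩ ⟨n', c'⟩ h
    rw [Composition.sigma_eq_iff_blocks_eq]
    have := congrArg (fun s : (Σ k, Fin k → ℕ) => List.ofFn s.2) h
    simpa [Composition.ofFn_blocksFun] using this
  refine (ENNReal.tsum_comp_le_tsum_of_injective hinj (fun s : (Σ k, Fin k → ℕ) =>
    (‖q s.1‖₊ : ℝ≥0∞) * ∏ j, ((‖p (s.2 j)‖₊ : ℝ≥0∞) * R ^ (s.2 j)))).trans ?_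
  rw [ENNReal.tsum_sigma']
  refine ENNReal.tsum_le_tsum fun k => ?_
  show ∑' b : Fin k → ℕ, (‖q k‖₊ : ℝ≥0∞) * ∏ j, ((‖p (b j)‖₊ : ℝ≥0∞) * R ^ (b j)) ≤ _
  rw [ENNReal.tsum_mul_left]
  rw [aux_tsum_pi (fun n => (‖p n‖₊ : ℝ≥0∞) * R ^ n)]
  rfl

open scoped ENNReal NNReal in
theorem serN_contr {E F G : Type*} [NormedAddCommGroup E] [NormedSpace ℂ E] [NormedAddCommGroup F]
    [NormedSpace ℂ F] [NormedAddCommGroup G]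
    [NormedSpace ℂ G] (q : FormalMultilinearSeries ℂ F G) (p : FormalMultilinearSeries ℂ E F)
    (R c : ℝ≥0∞) (hc : c ≤ 1) (hp : serN p R ≤ c * R) (hq : q 0 = 0) :
    serN (q.comp p) R ≤ c * serN q R := by
  refine (serN_comp q p R).trans ?_
  unfold serN at hp ⊢
  rw [← ENNReal.tsum_mul_left]
  refine ENNReal.tsum_le_tsum fun n => ?_
  rcases n with _ | n
  · simp [hq]
  · calc _ ≤ (‖q (n+1)‖₊ : ℝ≥0∞) * (c * R) ^ (n+1) := by gcongr
      _ = (‖q (n+1)‖₊ : ℝ≥0∞) * (c ^ (n+1) * R ^ (n+1)) := by rw [mul_pow]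
      _ ≤ (‖q (n+1)‖₊ : ℝ≥0∞) * (c * R ^ (n+1)) := by
        gcongr
        exact pow_le_of_le_one zero_le hc (by omega)
      _ = _ := by ring

open scoped ENNReal NNReal in
theorem exists_radius {E F G : Type*} [NormedAddCommGroup E] [NormedSpace ℂ E]
    [NormedAddCommGroup F]
    [NormedSpace ℂ F] [NormedAddCommGroup G]
    [NormedSpace ℂ G] (q : FormalMultilinearSeries ℂ F G) (p : FormalMultilinearSeries ℂ E F)
    (hq : 0 < q.radius) (hp : 0 < p.radius) (hp0 : p 0 = 0) (hp1 : ‖p 1‖ < 1) :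
    ∃ R c : ℝ≥0, 0 < R ∧ c < 1 ∧ serN q R ≠ ⊤ ∧ serN p R ≤ c * R := by
  obtain ⟨R0, hR0, hR⟩ := ENNReal.lt_iff_exists_nnreal_btwn.1 (lt_min hq hp)
  rw [lt_min_iff] at hR
  have hR0' : 0 < R0 := by exact_mod_cast hR0
  have sq : serN q R0 ≠ ⊤ := by
    have := ENNReal.tsum_coe_ne_top_iff_summable.2 (q.summable_nnnorm_mul_pow hR.1)
    simpa [serN] using this
  have sp := p.summable_nnnorm_mul_pow hR.2
  have sp2 : Summable fun n => ‖p (n+2)‖₊ * R0 ^ n := by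
    have := ((NNReal.summable_nat_add_iff 2).2 sp).mul_right ((R0^2)⁻¹)
    refine this.congr fun n => ?_
    have : R0 ^ 2 ≠ 0 := by positivity
    field_simp
    ring
  set M := ∑' n, ‖p (n+2)‖₊ * R0 ^ n with hM
  obtain ⟨c, hc1, hc2⟩ := exists_between (show ‖p 1‖₊ < 1 from hp1)
  set R := min R0 ((c - ‖p 1‖₊) / (M + 1)) with hRdef
  have hRpos : 0 < R := lt_min hR0' (div_pos (tsub_pos_of_lt hc1) (by positivity))
  have hRM : ‖p 1‖₊ + R * M ≤ c := by
    have h1 : R * (M + 1) ≤ c - ‖p 1‖₊ := by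
      have := min_le_right R0 ((c - ‖p 1‖₊) / (M + 1))
      rwa [← hRdef, le_div_iff₀ (by positivity)] at this
    have h2 : R * M ≤ c - ‖p 1‖₊ := le_trans (by gcongr; simp) h1
    calc _ ≤ ‖p 1‖₊ + (c - ‖p 1‖₊) := by gcongr
      _ = c := add_tsub_cancel_of_le hc1.le
  refine ⟨R, c, hRpos, hc2, ?_, ?_⟩
  · refine ne_top_of_le_ne_top sq ?_
    unfold serN
    refine ENNReal.tsum_le_tsum fun n => ?_
    gcongr
    exact min_le_left _ _
  · have hS : ∑' n, (‖p (n+2)‖₊ : ℝ≥0∞) * (R:ℝ≥0∞) ^ (n+2) ≤ ((R * R * M : ℝ≥0) : ℝ≥0∞) := by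
      rw [hM, ENNReal.coe_mul, ENNReal.coe_tsum sp2, ← ENNReal.tsum_mul_left]
      refine ENNReal.tsum_le_tsum fun n => ?_
      have : (R:ℝ≥0∞) ≤ R0 := by exact_mod_cast min_le_left _ _
      calc (‖p (n+2)‖₊ : ℝ≥0∞) * (R:ℝ≥0∞) ^ (n+2)
          = R * R * (‖p (n+2)‖₊ * (R:ℝ≥0∞) ^ n) := by ring
        _ ≤ R * R * (‖p (n+2)‖₊ * (R0:ℝ≥0∞) ^ n) := by gcongr
        _ = _ := by push_cast; rfl
    have : serN p R = ‖p 1‖₊ * R + ∑' n, (‖p (n+2)‖₊ : ℝ≥0∞) * (R:ℝ≥0∞) ^ (n+2) := by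
      unfold serN
      rw [tsum_eq_zero_add' ENNReal.summable, tsum_eq_zero_add' ENNReal.summable]
      simp [hp0]
    rw [this]
    refine (add_le_add_right hS _).trans ?_
    norm_cast
    calc ‖p 1‖₊ * R + R * R * M = (‖p 1‖₊ + R * M) * R := by ring
      _ ≤ c * R := by gcongr

open scoped ENNReal NNReal in
theorem formal_solve {E G : Type*} [NormedAddCommGroup E] [NormedSpace ℂ E]
    [NormedAddCommGroup G]
    [NormedSpace ℂ G] [CompleteSpace G]
    (q : FormalMultilinearSeries ℂ E G) (p : FormalMultilinearSeries ℂ E E)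
    (hq : 0 < q.radius) (hp : 0 < p.radius) (hp0 : p 0 = 0) (hp1 : ‖p 1‖ < 1) (hq0 : q 0 = 0) :
    ∃ s : FormalMultilinearSeries ℂ E G, 0 < s.radius ∧ s 0 = 0 ∧ s = q + s.comp p := by
  obtain ⟨R, c, hR, hc, hN, hpR⟩ := exists_radius q p hq hp hp0 hp1
  let P : ℕ → FormalMultilinearSeries ℂ E G := fun n => (fun s => s.comp p)^[n] q
  have P0 : P 0 = q := rfl
  have Ps : ∀ n, P (n+1) = (P n).comp p := fun n => Function.iterate_succ_apply' _ _ _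
  have Pz : ∀ n, P n 0 = 0 := by
    intro n
    induction n with
    | zero => exact hq0
    | succ n ih =>
      rw [Ps]; ext v
      rw [FormalMultilinearSeries.comp_coeff_zero _ _ v (fun i => i.elim0), ih]; rfl
  have PN : ∀ n, serN (P n) R ≤ (c:ℝ≥0∞) ^ n * serN q R := by
    intro n
    induction n with
    | zero => simp [P0]
    | succ n ih =>
      rw [Ps]
      refine (serN_contr _ _ _ c (by exact_mod_cast hc.le) hpR (Pz n)).trans ?_
      rw [pow_succ', mul_assoc]; gcongr
  set N : ℝ≥0 := (serN q R).toNNReal with hNdef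
  have hNN : serN q R = N := (ENNReal.coe_toNNReal hN).symm
  have B : ∀ n k, ‖P n k‖ * (R:ℝ) ^ k ≤ (c:ℝ) ^ n * N := by
    intro n k
    have : (‖P n k‖₊ : ℝ≥0∞) * (R:ℝ≥0∞) ^ k ≤ (c:ℝ≥0∞) ^ n * N := by
      rw [← hNN]
      exact (ENNReal.le_tsum (f := fun k => (‖P n k‖₊ : ℝ≥0∞) * (R:ℝ≥0∞) ^ k) k).trans (PN n)
    norm_cast at this
  have hRk : ∀ k, (0:ℝ) < (R:ℝ) ^ k := fun k => by positivity
  have B' : ∀ k n, ‖P n k‖ ≤ (c:ℝ) ^ n * (N / (R:ℝ) ^ k) := by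
    intro k n
    rw [← mul_div_assoc, le_div_iff₀ (hRk k)]; exact B n k
  have hg : ∀ k, HasSum (fun n => (c:ℝ) ^ n * (N / (R:ℝ) ^ k)) ((1 - (c:ℝ))⁻¹ * (N / (R:ℝ) ^ k)) :=
    fun k => (hasSum_geometric_of_lt_one c.2 (by exact_mod_cast hc)).mul_right _
  have hs : ∀ k, Summable (fun n => P n k) := fun k =>
    Summable.of_norm_bounded (hg k).summable (B' k)
  let s : FormalMultilinearSeries ℂ E G := fun k => ∑' n, P n k
  have hss : ∀ k, HasSum (fun n => P n k) (s k) := fun k => (hs k).hasSum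
  have hsv : ∀ k v, HasSum (fun n => P n k v) (s k v) := fun k v =>
    (hss k).mapL (ContinuousMultilinearMap.apply ℂ (fun _ : Fin k => E) G v)
  refine ⟨s, ?_, ?_, ?_⟩
  · refine lt_of_lt_of_le (ENNReal.coe_pos.2 hR) (s.le_radius_of_bound ((1 - (c:ℝ))⁻¹ * N) fun k => ?_)
    have := tsum_of_norm_bounded (hg k) (B' k)
    rw [← mul_div_assoc, le_div_iff₀ (hRk k)] at this
    exact this
  · show ∑' n, P n 0 = 0
    simp [Pz]
  · funext k
    ext v
    have h1 : HasSum (fun n => P (n+1) k v) ((s.comp p) k v) := by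
      simp only [Ps]
      simp only [FormalMultilinearSeries.comp, _root_.sum_apply,
        FormalMultilinearSeries.compAlongComposition_apply]
      exact hasSum_sum fun c _ => hsv _ _
    have h2 := (hasSum_nat_add_iff' (f := fun n => P n k v) 1).2 (hsv k v)
    have h3 := h1.unique h2
    simp only [Finset.sum_range_one, P0] at h3
    show s k v = q k v + (s.comp p) k v
    rw [h3]; abel

theorem analytic_solve {E G : Type*} [NormedAddCommGroup E] [NormedSpace ℂ E]
    [NormedAddCommGroup G]
    [NormedSpace ℂ G] [CompleteSpace G] (F : E → E) (ψ : E → G) (hF : AnalyticAt ℂ F 0)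
    (hF0 : F 0 = 0) (hψ : AnalyticAt ℂ ψ 0) (hψ0 : ψ 0 = 0) (hn : ‖fderiv ℂ F 0‖ < 1) :
    ∃ T : E → G, AnalyticAt ℂ T 0 ∧ T 0 = 0 ∧ ∀ᶠ x in nhds 0, T x = ψ x + T (F x) := by
  obtain ⟨p, hp⟩ := hF
  obtain ⟨q, hq⟩ := hψ
  have hp0 : p 0 = 0 := by ext v; rw [hp.coeff_zero, hF0]; rfl
  have hq0 : q 0 = 0 := by ext v; rw [hq.coeff_zero, hψ0]; rfl
  have hp1 : ‖p 1‖ < 1 := by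
    rw [hp.fderiv_eq, LinearIsometryEquiv.norm_map] at hn
    exact hn
  obtain ⟨s, hsr, hs0, hs⟩ := formal_solve q p hq.radius_pos hp.radius_pos hp0 hp1 hq0
  have hT := (s.hasFPowerSeriesOnBall hsr).hasFPowerSeriesAt
  refine ⟨s.sum, hT.analyticAt, ?_, ?_⟩
  · rw [← hT.coeff_zero (fun i => i.elim0), hs0]; rfl
  · have hT' : HasFPowerSeriesAt s.sum s (F 0) := by rwa [hF0]
    have h2 := hq.add (hT'.comp hp)
    rw [← hs] at h2
    filter_upwards [hT.eventually_hasSum, h2.eventually_hasSum] with x h3 h4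
    simpa using h3.unique h4

open scoped ENNReal NNReal in
theorem pow_small {E : Type*} [NormedAddCommGroup E] [NormedSpace ℂ E] [FiniteDimensional ℂ E]
    (A : E →L[ℂ] E)
    (h : ∀ c : ℂ, Module.End.HasEigenvalue A.toLinearMap c → ‖c‖ < 1) :
    ∀ᶠ n in Filter.atTop, ‖A ^ n‖ < 1 := by
  haveI : CompleteSpace E := FiniteDimensional.complete ℂ E
  have hsp : ∀ c ∈ spectrum ℂ A, ‖c‖₊ < 1 := by
    intro c hc
    refine h c ?_
    rw [Module.End.hasEigenvalue_iff_mem_spectrum]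
    have := AlgEquiv.spectrum_eq (Module.End.toContinuousLinearMap (𝕜 := ℂ) E) A.toLinearMap
    rw [← this]
    exact hc
  have hr : spectralRadius ℂ A < 1 := by
    rcases (spectrum ℂ A).eq_empty_or_nonempty with he | hne
    · simp [spectralRadius, he]
    · exact_mod_cast spectrum.spectralRadius_lt_of_forall_lt_of_nonempty hne hsp
  have := (spectrum.pow_nnnorm_pow_one_div_tendsto_nhds_spectralRadius A).eventually_lt_const hr
  filter_upwards [this, Filter.eventually_gt_atTop 0] with n hn hn0
  by_contra hcon
  push Not at hcon
  have h1 : (1 : ℝ≥0∞) ≤ (‖A ^ n‖₊ : ℝ≥0∞) := by exact_mod_cast hcon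
  exact absurd hn (not_lt.2 (ENNReal.one_le_rpow h1 (by positivity)))

theorem iterate_analytic {E : Type*} [NormedAddCommGroup E] [NormedSpace ℂ E] (f : E → E)
    (hf : AnalyticAt ℂ f 0) (h0 : f 0 = 0) (n : ℕ) : AnalyticAt ℂ (f^[n]) 0 := by
  induction n with
  | zero => exact analyticAt_id
  | succ n ih =>
    rw [Function.iterate_succ]
    exact AnalyticAt.comp_of_eq ih hf h0

theorem perm_solve {E : Type*} [NormedAddCommGroup E] [NormedSpace ℂ E] [FiniteDimensional ℂ E]
    {r : ℕ} (f : E → E) (ψ : E → Fin r → ℂ) (hf : AnalyticAt ℂ f 0)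
    (hf0 : f 0 = 0) (hψ : AnalyticAt ℂ ψ 0) (hψ0 : ψ 0 = 0)
    (h : ∀ c : ℂ, Module.End.HasEigenvalue (fderiv ℂ f 0).toLinearMap c → ‖c‖ < 1)
    (τ : Equiv.Perm (Fin r)) :
    ∃ S : E → Fin r → ℂ, AnalyticAt ℂ S 0 ∧ S 0 = 0 ∧
      ∀ᶠ x in nhds 0, ∀ i, S x (τ i) = ψ x i + S (f x) i := by
  obtain ⟨n0, hn0⟩ := Filter.eventually_atTop.1 (pow_small _ h)
  set m := orderOf τ * (n0 + 1) with hm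
  have hmτ : (τ⁻¹) ^ m = 1 := by
    rw [inv_pow, hm, pow_mul, pow_orderOf_eq_one, one_pow, inv_one]
  have hmn : n0 ≤ m := by
    have := orderOf_pos τ
    nlinarith
  have hfd : fderiv ℂ (f^[m]) 0 = (fderiv ℂ f 0) ^ m :=
    (HasFDerivAt.iterate hf.differentiableAt.hasFDerivAt hf0 m).fderiv
  have hit0 : ∀ n, f^[n] 0 = 0 := fun n => Function.iterate_fixed hf0 n
  have hψ' : AnalyticAt ℂ (fun x j => ψ x (τ⁻¹ j)) 0 :=
    analyticAt_pi_iff.2 fun j => (analyticAt_pi_iff (f := fun i x => ψ x i)).1 hψ (τ⁻¹ j)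
  obtain ⟨T, hT, hT0, hTe⟩ := analytic_solve (f^[m]) (fun x j => ψ x (τ⁻¹ j))
    (iterate_analytic f hf hf0 m) (hit0 m) hψ' (by funext j; simp [hψ0])
    (by rw [hfd]; exact hn0 m hmn)
  refine ⟨fun x j => ∑ b ∈ Finset.range m, T (f^[b] x) ((τ⁻¹ ^ b) j), ?_, ?_, ?_⟩
  · refine analyticAt_pi_iff.2 fun j => ?_
    refine Finset.analyticAt_fun_sum _ fun b _ => ?_
    have := AnalyticAt.comp_of_eq hT (iterate_analytic f hf hf0 b) (hit0 b)
    exact (analyticAt_pi_iff (f := fun i x => T (f^[b] x) i)).1 this _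
  · funext j
    simp [hit0, hT0]
  · filter_upwards [hTe] with x hx i
    have h1 := Finset.sum_range_succ (fun b => T (f^[b] x) ((τ⁻¹ ^ b) (τ i))) m
    have h2 := Finset.sum_range_succ' (fun b => T (f^[b] x) ((τ⁻¹ ^ b) (τ i))) m
    rw [h1, hmτ] at h2
    have hii : τ⁻¹ (τ i) = i := τ.symm_apply_apply i
    have h3 := congrFun hx (τ i)
    simp only [Pi.add_apply, hii] at h3
    simp only [Function.iterate_succ_apply, pow_succ, Equiv.Perm.mul_apply,
      hii, pow_zero, Equiv.Perm.one_apply, Function.iterate_zero, id] at h2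
    linear_combination h2 + h3

/-- the coordinate change. -/
noncomputable def chg {r p t : ℕ} (H : Sp r p t → Fin r → ℂ) (x : Sp r p t) : Sp r p t :=
  (fun i => x.1 i * H x i, x.2.1, x.2.2)

theorem an_u {r p t : ℕ} (i : Fin r) (a : Sp r p t) :
    AnalyticAt ℂ (fun x : Sp r p t => x.1 i) a :=
  (analyticAt_pi_iff (f := fun i (x : Sp r p t) => x.1 i)).1 analyticAt_fst i

theorem an_y {r p t : ℕ} (i : Fin p) (a : Sp r p t) :
    AnalyticAt ℂ (fun x : Sp r p t => x.2.1 i) a :=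
  (analyticAt_pi_iff (f := fun i (x : Sp r p t) => x.2.1 i)).1
    (analyticAt_fst.comp analyticAt_snd) i

theorem an_comp {E : Type*} [NormedAddCommGroup E] [NormedSpace ℂ E] {r : ℕ} {H : E → Fin r → ℂ}
    {a : E} (hH : AnalyticAt ℂ H a) (i : Fin r) : AnalyticAt ℂ (fun x => H x i) a :=
  (analyticAt_pi_iff (f := fun i x => H x i)).1 hH i

theorem chg_analytic {r p t : ℕ} (H : Sp r p t → Fin r → ℂ) (hH : AnalyticAt ℂ H 0) :
    AnalyticAt ℂ (chg H) 0 := by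
  refine AnalyticAt.prod ?_ (AnalyticAt.prod ?_ ?_)
  · exact analyticAt_pi_iff.2 fun i => (an_u i 0).mul (an_comp hH i)
  · exact analyticAt_fst.comp analyticAt_snd
  · exact analyticAt_snd.comp analyticAt_snd

theorem chg_deriv {r p t : ℕ} (H : Sp r p t → Fin r → ℂ) (hH : AnalyticAt ℂ H 0)
    (hH0 : H 0 = 1) :
    HasFDerivAt (chg H)
      ((ContinuousLinearEquiv.refl ℂ (Sp r p t) : Sp r p t ≃L[ℂ] Sp r p t) :
        Sp r p t →L[ℂ] Sp r p t) 0 := by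
  have h1 : HasFDerivAt (fun x : Sp r p t => fun i => x.1 i * H x i)
      (ContinuousLinearMap.fst ℂ (Fin r → ℂ) ((Fin p → ℂ) × (Fin t → ℂ))) 0 := by
    rw [hasFDerivAt_pi']
    intro i
    have hu : HasFDerivAt (fun x : Sp r p t => x.1 i)
        ((ContinuousLinearMap.proj i).comp
          (ContinuousLinearMap.fst ℂ (Fin r → ℂ) ((Fin p → ℂ) × (Fin t → ℂ)))) 0 :=
      ((ContinuousLinearMap.proj (R := ℂ) i).comp
          (ContinuousLinearMap.fst ℂ (Fin r → ℂ) ((Fin p → ℂ) × (Fin t → ℂ)))).hasFDerivAt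
    have hh := (an_comp hH i).differentiableAt.hasFDerivAt
    refine (hu.mul hh).congr_fderiv ?_
    ext v <;> simp [hH0]
  have h2 : HasFDerivAt (fun x : Sp r p t => x.2)
      (ContinuousLinearMap.snd ℂ (Fin r → ℂ) ((Fin p → ℂ) × (Fin t → ℂ))) 0 :=
    (ContinuousLinearMap.snd ℂ (Fin r → ℂ) ((Fin p → ℂ) × (Fin t → ℂ))).hasFDerivAt
  exact h1.prodMk h2

theorem chg_zero {r p t : ℕ} (H : Sp r p t → Fin r → ℂ) : chg H 0 = 0 := by
  simp only [chg, Prod.fst_zero, Prod.snd_zero, Pi.zero_apply, zero_mul]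
  rfl

open scoped ContDiff in
theorem chg_inverse {r p t : ℕ} (H : Sp r p t → Fin r → ℂ) (hH : AnalyticAt ℂ H 0)
    (hH0 : H 0 = 1) : ∃ Ψ : Sp r p t → Sp r p t, AnalyticAt ℂ Ψ 0 ∧ Ψ 0 = 0 ∧
      ∀ᶠ x in nhds 0, Ψ (chg H x) = x := by
  have hc : ContDiffAt ℂ ω (chg H) 0 := (chg_analytic H hH).contDiffAt
  have hd := chg_deriv H hH hH0
  have hne : (ω : WithTop ℕ∞) ≠ 0 := by simp
  have hl : ∀ᶠ x in nhds 0, hc.localInverse hd hne (chg H x) = x :=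
    HasStrictFDerivAt.eventually_left_inverse _
  refine ⟨hc.localInverse hd hne, ?_, ?_, hl⟩
  · have := hc.to_localInverse hd hne
    rw [chg_zero] at this
    exact this.analyticAt
  · have := hl.self_of_nhds
    rwa [chg_zero] at this

theorem main_aux (r p t : ℕ)
    (β : Fin p → ℂ)
    (C : Matrix (Fin r) (Fin p) ℕ)
    (D : Matrix (Fin p) (Fin p) ℕ)
    (g : Sp r p t → Fin p → ℂ) (k : Sp r p t → Fin t → ℂ)
    (hga : AnalyticAt ℂ g 0) (hg0 : g 0 = 0)
    (hka : AnalyticAt ℂ k 0) (hk0 : k 0 = 0)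
    (H : Sp r p t → Fin r → ℂ) (hH : AnalyticAt ℂ H 0) (hH0 : H 0 = 1) :
    ∃ (g' : Sp r p t → Fin p → ℂ) (k' : Sp r p t → Fin t → ℂ),
      AnalyticAt ℂ g' 0 ∧ g' 0 = 0 ∧ AnalyticAt ℂ k' 0 ∧ k' 0 = 0 ∧
      ∀ᶠ x in nhds (0 : Sp r p t),
        (∀ i, β i * (∏ l, (chg H x).1 l ^ C l i) * (∏ l, (chg H x).2.1 l ^ D l i)
                 * (1 + g' (chg H x) i) =
          β i * (∏ l, x.1 l ^ C l i) * (∏ l, x.2.1 l ^ D l i) * (1 + g x i)) ∧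
        k' (chg H x) = k x := by
  obtain ⟨Ψ, hΨ, hΨ0, hΨi⟩ := chg_inverse H hH hH0
  have hHΨ : AnalyticAt ℂ (fun x => H (Ψ x)) 0 := AnalyticAt.comp_of_eq hH hΨ hΨ0
  have hgΨ : AnalyticAt ℂ (fun x => g (Ψ x)) 0 := AnalyticAt.comp_of_eq hga hΨ hΨ0
  refine ⟨fun w i => (1 + g (Ψ w) i) * (∏ l, H (Ψ w) l ^ C l i)⁻¹ - 1, fun w => k (Ψ w),
    ?_, ?_, AnalyticAt.comp_of_eq hka hΨ hΨ0, ?_, ?_⟩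
  · refine analyticAt_pi_iff.2 fun i => ?_
    refine AnalyticAt.sub (AnalyticAt.mul (analyticAt_const.add (an_comp hgΨ i)) ?_)
      analyticAt_const
    refine AnalyticAt.fun_inv (Finset.analyticAt_fun_prod _ fun l _ =>
      (an_comp hHΨ l).pow _) ?_
    simp [hΨ0, hH0]
  · funext i
    simp [hΨ0, hH0, hg0]
  · simp [hΨ0, hk0]
  · have hne : ∀ᶠ x in nhds (0 : Sp r p t), ∀ l, H x l ≠ 0 := by
      rw [Filter.eventually_all]
      intro l
      refine (an_comp hH l).continuousAt.eventually_ne ?_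
      simp [hH0]
    filter_upwards [hΨi, hne] with x hx hxH
    refine ⟨fun i => ?_, by rw [hx]⟩
    simp only [hx]
    have : ∏ l, H x l ^ C l i ≠ 0 := Finset.prod_ne_zero_iff.2 fun l _ => pow_ne_zero _ (hxH l)
    simp only [chg, mul_pow, Finset.prod_mul_distrib]
    field_simp
    ring

/-- Theorem on the linear part: a contracting holomorphic germ of the form
`f(u,y,w) = (α u^B (1+θ), β u^C y^D (1+g), k)`, with `B` a permutation matrix,
is holomorphically conjugated to a germ of the form
`f̃(u,y,w) = (α u^B, β u^C y^D (1+g̃), k̃)`. -/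
theorem stmt_1 (r p t : ℕ)
    (f : Sp r p t → Sp r p t)
    (α : Fin r → ℂ) (β : Fin p → ℂ)
    (B : Matrix (Fin r) (Fin r) ℕ) (C : Matrix (Fin r) (Fin p) ℕ)
    (D : Matrix (Fin p) (Fin p) ℕ)
    (θ : Sp r p t → Fin r → ℂ) (g : Sp r p t → Fin p → ℂ) (k : Sp r p t → Fin t → ℂ)
    (hα : ∀ i, α i ≠ 0) (hβ : ∀ i, β i ≠ 0)
    (hB : ∃ τ : Equiv.Perm (Fin r), ∀ l i, B l i = if l = τ i then 1 else 0)
    (hθa : AnalyticAt ℂ θ 0) (hθ0 : θ 0 = 0)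
    (hga : AnalyticAt ℂ g 0) (hg0 : g 0 = 0)
    (hka : AnalyticAt ℂ k 0) (hk0 : k 0 = 0)
    (hf : ∀ u y w, f (u, y, w) =
      (fun i => α i * (∏ l, u l ^ B l i) * (1 + θ (u, y, w) i),
       fun i => β i * (∏ l, u l ^ C l i) * (∏ l, y l ^ D l i) * (1 + g (u, y, w) i),
       k (u, y, w)))
    (hcontr : ∀ c : ℂ,
      Module.End.HasEigenvalue (fderiv ℂ f 0).toLinearMap c → ‖c‖ < 1) :
    ∃ (g' : Sp r p t → Fin p → ℂ) (k' : Sp r p t → Fin t → ℂ),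
      AnalyticAt ℂ g' 0 ∧ g' 0 = 0 ∧ AnalyticAt ℂ k' 0 ∧ k' 0 = 0 ∧
      ∃ (Φ : Sp r p t → Sp r p t) (L : Sp r p t ≃L[ℂ] Sp r p t),
        AnalyticAt ℂ Φ 0 ∧ Φ 0 = 0 ∧
        HasFDerivAt Φ (L : Sp r p t →L[ℂ] Sp r p t) 0 ∧
        ∀ᶠ x in nhds (0 : Sp r p t), Φ (f x) =
          (fun w : Sp r p t =>
            (fun i => α i * ∏ l, w.1 l ^ B l i,
             fun i => β i * (∏ l, w.1 l ^ C l i) * (∏ l, w.2.1 l ^ D l i)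
                 * (1 + g' w i),
             k' w)) (Φ x) := by
  classical
  obtain ⟨τ, hτ⟩ := hB
  have hprod : ∀ (v : Fin r → ℂ) i, ∏ l, v l ^ B l i = v (τ i) := by
    intro v i
    rw [Finset.prod_eq_single (τ i)]
    · simp [hτ]
    · intro l _ hl; simp [hτ, hl]
    · simp
  have hf' : ∀ x, f x = (fun i => α i * x.1 (τ i) * (1 + θ x i),
       fun i => β i * (∏ l, x.1 l ^ C l i) * (∏ l, x.2.1 l ^ D l i) * (1 + g x i),
       k x) := by
    rintro ⟨u, y, w⟩
    rw [hf]; simp only [hprod]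
  have hfa : AnalyticAt ℂ f 0 := by
    rw [show f = _ from funext hf']
    refine AnalyticAt.prod ?_ (AnalyticAt.prod ?_ hka)
    · exact analyticAt_pi_iff.2 fun i => (analyticAt_const.mul (an_u _ 0)).mul
        (analyticAt_const.add (an_comp hθa i))
    · exact analyticAt_pi_iff.2 fun i => ((analyticAt_const.mul
        (Finset.analyticAt_fun_prod _ fun l _ => (an_u l 0).pow _)).mul
        (Finset.analyticAt_fun_prod _ fun l _ => (an_y l 0).pow _)).mul
        (analyticAt_const.add (an_comp hga i))
  simp only [hprod]
  by_cases hf0 : f 0 = 0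
  · have hψ : AnalyticAt ℂ (fun x i => Complex.log (1 + θ x i)) 0 :=
      analyticAt_pi_iff.2 fun i => (analyticAt_const.add (an_comp hθa i)).clog
        (by simp [hθ0])
    obtain ⟨S, hS, hS0, hSe⟩ := perm_solve f (fun x i => Complex.log (1 + θ x i)) hfa hf0 hψ
      (by funext i; simp [hθ0]) hcontr τ
    set H : Sp r p t → Fin r → ℂ := fun x i => Complex.exp (S x i) with hHdef
    have hH : AnalyticAt ℂ H 0 := analyticAt_pi_iff.2 fun i => (an_comp hS i).cexp
    have hH0 : H 0 = 1 := by funext i; simp [hHdef, hS0]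
    obtain ⟨g', k', hg', hg'0, hk', hk'0, he⟩ :=
      main_aux r p t β C D g k hga hg0 hka hk0 H hH hH0
    refine ⟨g', k', hg', hg'0, hk', hk'0, chg H, ContinuousLinearEquiv.refl ℂ _,
      chg_analytic H hH, chg_zero H, chg_deriv H hH hH0, ?_⟩
    have hne : ∀ᶠ x in nhds (0 : Sp r p t), ∀ l, 1 + θ x l ≠ 0 := by
      rw [Filter.eventually_all]
      intro l
      refine (analyticAt_const.add (an_comp hθa l)).continuousAt.eventually_ne ?_
      simp [hθ0]
    filter_upwards [he, hSe, hne] with x hx hxS hxn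
    refine Prod.ext ?_ (Prod.ext ?_ ?_)
    · funext i
      have h1 : H x (τ i) = (1 + θ x i) * H (f x) i := by
        simp only [hHdef]
        rw [hxS i, Complex.exp_add, Complex.exp_log (hxn i)]
      have h2 : (f x).1 i = α i * x.1 (τ i) * (1 + θ x i) := by rw [hf' x]
      show (f x).1 i * H (f x) i = α i * (x.1 (τ i) * H x (τ i))
      rw [h1, h2]; ring
    · funext i
      show (f x).2.1 i = _
      rw [hf' x]
      exact (hx.1 i).symm
    · show (f x).2.2 = _
      rw [hf' x]
      exact hx.2.symm
  · set H : Sp r p t → Fin r → ℂ := fun x i => 1 + θ x (τ.symm i) with hHdef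
    have hH : AnalyticAt ℂ H 0 :=
      analyticAt_pi_iff.2 fun i => analyticAt_const.add (an_comp hθa _)
    have hH0 : H 0 = 1 := by funext i; simp [hHdef, hθ0]
    obtain ⟨g', k', hg', hg'0, hk', hk'0, he⟩ :=
      main_aux r p t β C D g k hga hg0 hka hk0 H hH hH0
    set ε := ‖f 0‖ / 2 with hε
    have hεp : 0 < ε := by have := norm_pos_iff.2 hf0; positivity
    have hnb : ∀ᶠ x in nhds (0 : Sp r p t), ‖x‖ < ε := by
      have := Metric.ball_mem_nhds (0 : Sp r p t) hεp
      filter_upwards [this] with x hx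
      simpa using hx
    set Φ : Sp r p t → Sp r p t := fun x => if ‖x‖ < ε then chg H x else x with hΦ
    have hΦe : Φ =ᶠ[nhds 0] chg H := by
      filter_upwards [hnb] with x hx
      simp [hΦ, hx]
    refine ⟨g', k', hg', hg'0, hk', hk'0, Φ, ContinuousLinearEquiv.refl ℂ _,
      (chg_analytic H hH).congr hΦe.symm, by rw [hΦe.self_of_nhds, chg_zero],
      (chg_deriv H hH hH0).congr_of_eventuallyEq hΦe, ?_⟩
    have hfar : ∀ᶠ x in nhds (0 : Sp r p t), ε < ‖f x‖ := by
      refine hfa.continuousAt.norm.eventually_const_lt ?_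
      have := norm_pos_iff.2 hf0
      linarith
    filter_upwards [he, hΦe, hfar] with x hx hxΦ hxf
    have h0 : Φ (f x) = f x := by simp [hΦ, not_lt.2 hxf.le]
    rw [h0, hxΦ]
    refine Prod.ext ?_ (Prod.ext ?_ ?_)
    · funext i
      have h2 : (f x).1 i = α i * x.1 (τ i) * (1 + θ x i) := by rw [hf' x]
      show (f x).1 i = α i * (x.1 (τ i) * H x (τ i))
      rw [h2]; simp [hHdef]; ring
    · funext i
      rw [hf' x]
      exact (hx.1 i).symm
    · rw [hf' x]
      exact hx.2.symm


end
end

section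
/- Let d = s + p + 1 and let f : (ℂ^d,0) → (ℂ^d,0) be a contracting holomorphic germ which, in coordinates (x, y, z) with x = (u,v) ∈ ℂ^r × ℂ^e (s = r + e), y ∈ ℂ^p, z ∈ ℂ, has the form f(x,y,z) = (γ x^P + σ(x), β x^E y^D (1 + g(x)), ν x^l y^m z (1 + ε(x,y,z)) + ω(x,y)), where: γ = (α, μ) ∈ (ℂ*)^s with 0 < |μ_k| < 1 for all k; β ∈ (ℂ*)^p; ν ∈ ℂ*; P is the s×s permutation matrix B ⊕ Id_e with B an r×r permutation matrix; E ∈ M_{s×p}(ℕ); D ∈ M_{p×p}(ℕ) with det D ≠ 0; (l, m) ∈ ℕ^s × ℕ^p with (l,m) ≠ (0,0); σ = (0, ρ) where ρ : ℂ^s → ℂ^e is a polynomial map vanishing at 0 such that every monomial u^{n_u} v^{n_v} appearing with nonzero coefficient in the k-th component of ρ is primary resonant with respect to the k-th coordinate of v (for the data α, B, μ); g : ℂ^s → ℂ^p is a polynomial map vanishing at 0 all of whose monomials are secondary resonant (for the data γ, P, D); and ε : (ℂ^d,0) → (ℂ,0) and ω : (ℂ^{s+p},0) → (ℂ,0) are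 holomorphic germs vanishing at 0. Then f is holomorphically conjugated to a germ of the form f̃(x,y,z) = (γ x^P + σ(x), β x^E y^D (1 + g(x)), ν x^l y^m z + ω̃(x,y)) for some holomorphic germ ω̃ : (ℂ^{s+p},0) → (ℂ,0). -/
noncomputable section

/-- `ℂ^a × ℂ^b × ℂ^c × ℂ`; the first two factors together form the coordinate
`x = (u,v) ∈ ℂ^s`, `s = a + b`, and the last factor is the coordinate `z ∈ ℂ`. -/
abbrev SpZ (a b c : ℕ) : Type :=
  (Fin a → ℂ) × (Fin b → ℂ) × (Fin c → ℂ) × ℂ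


lemma aux_cauchy1 {E G : Type*} [NormedAddCommGroup E] [NormedSpace ℂ E]
    [NormedAddCommGroup G] [NormedSpace ℂ G]
    {F : E → G} {R M δ : ℝ} (hF : DifferentiableOn ℂ F (Metric.ball 0 R))
    (hM : ∀ x ∈ Metric.ball (0:E) R, ‖F x‖ ≤ M) (hδ : 0 < δ) (x : E) (hx : ‖x‖ + δ < R) :
    ‖fderiv ℂ F x‖ ≤ M / δ := by
  have hxb : x ∈ Metric.ball (0:E) R := by simp; linarith
  have hM0 : 0 ≤ M := (norm_nonneg _).trans (hM x hxb)
  refine ContinuousLinearMap.opNorm_le_bound _ (by positivity) fun v => ?_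
  by_cases hv : v = 0
  · simp [hv]
  have hv' : 0 < ‖v‖ := norm_pos_iff.2 hv
  have hmem : ∀ t : ℂ, ‖t‖ ≤ δ / ‖v‖ → x + t • v ∈ Metric.ball (0:E) R := by
    intro t ht
    have : ‖t‖ * ‖v‖ ≤ δ := by rwa [le_div_iff₀ hv'] at ht
    have h2 := norm_add_le x (t • v)
    rw [norm_smul] at h2
    simp; linarith
  have hline : ∀ t : ℂ, HasDerivAt (fun t : ℂ => x + t • v) v t := fun t => by
    simpa using ((hasDerivAt_id t).smul_const v).const_add x
  have hd : deriv (fun t : ℂ => F (x + t • v)) 0 = fderiv ℂ F x v := by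
    have h1 : HasFDerivAt F (fderiv ℂ F x) (x + (0:ℂ) • v) := by
      simpa using (hF.differentiableAt (Metric.isOpen_ball.mem_nhds hxb)).hasFDerivAt
    exact (h1.comp_hasDerivAt (0:ℂ) (hline 0)).deriv
  have hdc : DiffContOnCl ℂ (fun t : ℂ => F (x + t • v)) (Metric.ball 0 (δ/‖v‖)) := by
    apply DifferentiableOn.diffContOnCl
    rw [closure_ball _ (by positivity)]
    intro t ht
    have h1 := hF.differentiableAt (Metric.isOpen_ball.mem_nhds (hmem t (by simpa using ht)))
    exact (h1.comp t (hline t).differentiableAt).differentiableWithinAt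
  have := Complex.norm_deriv_le_of_forall_mem_sphere_norm_le (by positivity) hdc
    (C := M) (fun t ht => hM _ (hmem t (by simp at ht; exact ht.le)))
  rw [hd] at this
  refine this.trans (le_of_eq ?_)
  field_simp

lemma aux_cauchyk {E G : Type*} [NormedAddCommGroup E] [NormedSpace ℂ E]
    [NormedAddCommGroup G] [NormedSpace ℂ G] [CompleteSpace G]
    {F : E → G} {R M δ : ℝ} (hF : AnalyticOnNhd ℂ F (Metric.ball 0 R))
    (hM : ∀ x ∈ Metric.ball (0:E) R, ‖F x‖ ≤ M) (hδ : 0 < δ) (k : ℕ) :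
    ∀ x : E, ‖x‖ + k * δ < R → ‖iteratedFDeriv ℂ k F x‖ ≤ M / δ ^ k := by
  induction k with
  | zero => intro x hx; simpa using hM x (by simpa using hx)
  | succ k ih =>
    intro x hx
    rw [← norm_fderiv_iteratedFDeriv]
    push_cast at hx
    have h := aux_cauchy1 (F := iteratedFDeriv ℂ k F) (R := R - k * δ) (M := M / δ ^ k) (δ := δ)
      (((hF.iteratedFDeriv k).mono (Metric.ball_subset_ball (by nlinarith [mul_nonneg (Nat.cast_nonneg k : (0:ℝ) ≤ k) hδ.le]))).differentiableOn)
      (fun y hy => ih y (by simp at hy; linarith)) hδ x (by linarith)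
    rw [pow_succ, ← div_div]; exact h

/-- Taylor coefficients. -/
def auxTay {E : Type*} [NormedAddCommGroup E] [NormedSpace ℂ E] (F : E → ℂ) :
    FormalMultilinearSeries ℂ E ℂ := fun k => ((k.factorial : ℂ)⁻¹) • iteratedFDeriv ℂ k F 0

lemma auxTay_bound {E : Type*} [NormedAddCommGroup E] [NormedSpace ℂ E]
    {F : E → ℂ} {R M : ℝ} (hR : 0 < R) (hF : AnalyticOnNhd ℂ F (Metric.ball 0 R))
    (hM : ∀ x ∈ Metric.ball (0:E) R, ‖F x‖ ≤ M) (k : ℕ) :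
    ‖auxTay F k‖ ≤ M * (2 * Real.exp 1 / R) ^ k := by
  have hM0 : 0 ≤ M := (norm_nonneg _).trans (hM 0 (by simpa using hR))
  unfold auxTay
  rcases Nat.eq_zero_or_pos k with rfl | hk
  · simpa using hM 0 (by simpa using hR)
  have hk' : (0:ℝ) < k := by exact_mod_cast hk
  have h := aux_cauchyk hF hM (δ := R / (2 * k)) (by positivity) k 0 (by
    simp; field_simp; norm_num)
  have he : (k:ℝ) ^ k / k.factorial ≤ Real.exp 1 ^ k := by
    have := Real.pow_div_factorial_le_exp k hk'.le k
    rwa [← Real.exp_nat_mul, mul_one]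
  rw [norm_smul, norm_inv, Complex.norm_natCast]
  have hf : (0:ℝ) < k.factorial := by exact_mod_cast k.factorial_pos
  calc (k.factorial:ℝ)⁻¹ * ‖iteratedFDeriv ℂ k F 0‖ ≤ (k.factorial:ℝ)⁻¹ * (M / (R / (2 * k)) ^ k) := by gcongr
    _ = M * (2 / R) ^ k * ((k:ℝ)^k / k.factorial) := by
      simp only [div_pow, mul_pow]; field_simp
    _ ≤ M * (2 / R) ^ k * Real.exp 1 ^ k := by gcongr
    _ = _ := by rw [mul_assoc, ← mul_pow]; congr 2; ring

lemma auxTay_hasSum {E : Type*} [NormedAddCommGroup E] [NormedSpace ℂ E]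
    {F : E → ℂ} {R M : ℝ} (hR : 0 < R) (hF : AnalyticOnNhd ℂ F (Metric.ball 0 R))
    (hM : ∀ x ∈ Metric.ball (0:E) R, ‖F x‖ ≤ M) (y : E) (hy : ‖y‖ < R / (2 * Real.exp 1)) :
    HasSum (fun k => auxTay F k (fun _ => y)) (F y) := by
  have hM0 : 0 ≤ M := (norm_nonneg _).trans (hM 0 (by simpa using hR))
  set ρ : NNReal := ⟨R / (2 * Real.exp 1), by positivity⟩ with hρ
  have hρ' : (ρ:ℝ) = R / (2 * Real.exp 1) := rfl
  have hρ0 : 0 < ρ := by rw [← NNReal.coe_pos, hρ']; positivity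
  have hrad : (ρ : ENNReal) ≤ (auxTay F).radius := by
    refine FormalMultilinearSeries.le_radius_of_bound _ M fun n => ?_
    have := auxTay_bound hR hF hM n
    calc ‖auxTay F n‖ * (ρ:ℝ) ^ n ≤ M * (2 * Real.exp 1 / R) ^ n * (ρ:ℝ)^n := by gcongr
      _ = M := by
        rw [mul_assoc, ← mul_pow, hρ']
        have : 2 * Real.exp 1 / R * (R / (2 * Real.exp 1)) = 1 := by
          have := Real.exp_pos 1
          field_simp
        rw [this]; simp
  have hpos : 0 < (auxTay F).radius := lt_of_lt_of_le (by exact_mod_cast hρ0) hrad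
  have hs := (auxTay F).hasFPowerSeriesOnBall hpos
  have hsum := hs.mono (by exact_mod_cast hρ0) hrad
  have hyb : y ∈ Metric.eball (0:E) ρ := by
    rw [Metric.mem_eball, edist_zero_right, ← ofReal_norm,  ENNReal.ofReal_lt_coe_iff]
    · exact hy
    · exact norm_nonneg _
  have hloc : (auxTay F).sum =ᶠ[nhds 0] F := by
    obtain ⟨p, r, hp⟩ := hF 0 (by simpa using hR)
    filter_upwards [Metric.eball_mem_nhds (0:E) hp.r_pos, Metric.eball_mem_nhds (0:E) hsum.r_pos] with x hx hx2
    have h1 := hp.hasSum_iteratedFDeriv hx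
    have h2 := hsum.hasSum hx2
    simp only [zero_add] at h1 h2
    exact h2.unique (by simpa [auxTay] using h1)
  have hball : Metric.eball (0:E) ρ ⊆ Metric.ball 0 R := by
    rw [Metric.eball_coe]
    apply Metric.ball_subset_ball
    rw [hρ']
    have := Real.add_one_le_exp 1
    exact div_le_self hR.le (by linarith)
  have heq := AnalyticOnNhd.eqOn_of_preconnected_of_eventuallyEq (hsum.analyticOnNhd)
    (hF.mono hball) (by rw [Metric.eball_coe]; exact (convex_ball _ _).isPreconnected)
    (Metric.mem_eball_self hsum.r_pos) hloc
  have h2 := hsum.hasSum hyb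
  rw [zero_add, heq hyb] at h2
  exact h2

lemma aux_series {E : Type*} [NormedAddCommGroup E] [NormedSpace ℂ E]
    {F : ℕ → E → ℂ} {R : ℝ} {M : ℕ → ℝ} (hR : 0 < R)
    (hF : ∀ n, AnalyticOnNhd ℂ (F n) (Metric.ball 0 R))
    (hM : ∀ n, ∀ x ∈ Metric.ball (0:E) R, ‖F n x‖ ≤ M n) (hs : Summable M) :
    AnalyticAt ℂ (fun x => ∑' n, F n x) 0 := by
  set K : ℝ := 2 * Real.exp 1 / R with hK
  have hK0 : 0 < K := by have := Real.exp_pos 1; positivity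
  have hM0 : ∀ n, 0 ≤ M n := fun n => (norm_nonneg _).trans (hM n 0 (by simpa using hR))
  let p : FormalMultilinearSeries ℂ E ℂ := fun k => ∑' n, auxTay (F n) k
  have hb : ∀ n k, ‖auxTay (F n) k‖ ≤ M n * K ^ k := fun n k => auxTay_bound hR (hF n) (hM n) k
  have hsk : ∀ k, Summable fun n => auxTay (F n) k := fun k =>
    Summable.of_norm_bounded (hs.mul_right (K^k)) (fun n => hb n k)
  have hp : ∀ k, ‖p k‖ ≤ (∑' n, M n) * K ^ k := fun k =>
    tsum_of_norm_bounded (hs.hasSum.mul_right (K^k)) (fun n => hb n k)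
  set ρ : NNReal := ⟨1 / (2 * K), by positivity⟩ with hρ
  have hρ' : (ρ:ℝ) = 1 / (2 * K) := rfl
  have hρ0 : 0 < ρ := by rw [← NNReal.coe_pos, hρ']; positivity
  have hKρ : K * ρ = 1/2 := by rw [hρ']; field_simp
  refine ⟨p, ρ, ?_, by exact_mod_cast hρ0, ?_⟩
  · refine FormalMultilinearSeries.le_radius_of_bound _ (∑' n, M n) fun k => ?_
    calc ‖p k‖ * (ρ:ℝ) ^ k ≤ (∑' n, M n) * K ^ k * (ρ:ℝ)^k := by gcongr; exact hp k
      _ = (∑' n, M n) * (1/2)^k := by rw [mul_assoc, ← mul_pow, hKρ]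
      _ ≤ (∑' n, M n) * 1 := by
        gcongr
        · exact tsum_nonneg hM0
        · exact pow_le_one₀ (by norm_num) (by norm_num)
      _ = _ := mul_one _
  · intro y hy
    have hy' : ‖y‖ < ρ := by
      rw [Metric.eball_coe] at hy; simpa using hy
    rw [zero_add]
    have hKy : K * ‖y‖ ≤ 1/2 := by rw [← hKρ]; gcongr
    have hdb : ∀ n k, ‖auxTay (F n) k (fun _ => y)‖ ≤ M n * (1/2)^k := fun n k => by
      calc _ ≤ ‖auxTay (F n) k‖ * ∏ _i : Fin k, ‖y‖ := ContinuousMultilinearMap.le_opNorm _ _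
        _ = ‖auxTay (F n) k‖ * ‖y‖ ^ k := by simp
        _ ≤ M n * K ^ k * ‖y‖ ^ k := by gcongr; exact hb n k
        _ = M n * (K * ‖y‖) ^ k := by rw [mul_assoc, ← mul_pow]
        _ ≤ _ := by have := hM0 n; gcongr
    have hds : Summable (fun q : ℕ × ℕ => auxTay (F q.1) q.2 (fun _ => y)) := by
      refine Summable.of_norm_bounded (g := fun q : ℕ × ℕ => M q.1 * (1/2:ℝ)^q.2) ?_ (fun q => hdb q.1 q.2)
      exact hs.mul_of_nonneg (summable_geometric_of_lt_one (by norm_num) (by norm_num)) hM0 (fun k => by positivity)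
    have h1 : ∀ n, HasSum (fun k => auxTay (F n) k (fun _ => y)) (F n y) := fun n =>
      auxTay_hasSum hR (hF n) (hM n) y (by
        refine hy'.trans_le (le_of_eq_of_le hρ' ?_)
        rw [hK]
        have := Real.exp_pos 1
        rw [div_le_div_iff₀ (by positivity) (by positivity)]
        field_simp; norm_num)
    have h2 : ∀ k, HasSum (fun n => auxTay (F n) k (fun _ => y)) (p k (fun _ => y)) := fun k => by
      have := (ContinuousMultilinearMap.apply ℂ (fun _ : Fin k => E) ℂ (fun _ => y)).hasSum (hsk k).hasSum
      exact this
    have h3 := hds.hasSum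
    have h4 := h3.prod_fiberwise h1
    rw [h4.tsum_eq]
    exact (((Equiv.prodComm ℕ ℕ).hasSum_iff.2 h3)).prod_fiberwise h2

lemma aux_solve_contr {E : Type*} [NormedAddCommGroup E] [NormedSpace ℂ E] [CompleteSpace E]
    {g : E → E} {K : E → ℂ} (hg : AnalyticAt ℂ g 0) (hg0 : g 0 = 0)
    (hA : ‖fderiv ℂ g 0‖ < 1) (hK : AnalyticAt ℂ K 0) (hK0 : K 0 = 0) :
    ∃ S : E → ℂ, AnalyticAt ℂ S 0 ∧ S 0 = 0 ∧ (∀ᶠ x in nhds 0, S x = K x + S (g x)) ∧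
      ∃ R > 0, ∃ c < 1, 0 ≤ c ∧ ∀ x ∈ Metric.ball (0:E) R, ‖g x‖ ≤ c * ‖x‖ := by
  obtain ⟨c, hc1, hc2⟩ := exists_between hA
  have hc0 : 0 < c := (norm_nonneg _).trans_lt hc1
  have hgc : ∀ᶠ x in nhds (0:E), ‖g x‖ ≤ c * ‖x‖ := by
    have h := hg.differentiableAt.hasFDerivAt.isLittleO.def (sub_pos.2 hc1)
    filter_upwards [h] with x hx
    simp only [hg0, sub_zero] at hx
    have h1 := (fderiv ℂ g 0).le_opNorm x
    have h2 := norm_add_le (g x - fderiv ℂ g 0 x) (fderiv ℂ g 0 x)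
    rw [sub_add_cancel] at h2
    nlinarith
  obtain ⟨C, hC0, hC⟩ := hK.differentiableAt.hasFDerivAt.isBigO_sub.exists_pos
  have hC := hC.bound
  obtain ⟨R, hR, hball⟩ := Metric.eventually_nhds_iff_ball.1
    (hgc.and (hC.and (hg.eventually_analyticAt.and hK.eventually_analyticAt)))
  have hmaps : Set.MapsTo g (Metric.ball 0 R) (Metric.ball 0 R) := by
    intro x hx
    have := (hball x hx).1
    simp at hx ⊢
    nlinarith [norm_nonneg x]
  have hit : ∀ n, ∀ x ∈ Metric.ball (0:E) R, ‖g^[n] x‖ ≤ c ^ n * ‖x‖ := by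
    intro n
    induction n with
    | zero => intro x _; simp
    | succ n ih =>
      intro x hx
      rw [Function.iterate_succ_apply]
      calc _ ≤ c ^ n * ‖g x‖ := ih _ (hmaps hx)
        _ ≤ c ^ n * (c * ‖x‖) := by gcongr; exact (hball x hx).1
        _ = _ := by ring
  have hana : ∀ n, AnalyticOnNhd ℂ (g^[n]) (Metric.ball 0 R) := by
    intro n
    induction n with
    | zero => intro x _; exact analyticAt_id
    | succ n ih =>
      rw [Function.iterate_succ]
      exact ih.comp (fun x hx => (hball x hx).2.2.1) hmaps
  have hbd : ∀ n, ∀ x ∈ Metric.ball (0:E) R, ‖K (g^[n] x)‖ ≤ C * R * c ^ n := by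
    intro n x hx
    have h := (hball _ (hmaps.iterate n hx)).2.1
    simp only [hK0, sub_zero] at h
    have h2 := hit n x hx
    have h3 : ‖x‖ ≤ R := by simp at hx; exact hx.le
    calc _ ≤ C * ‖g^[n] x‖ := h
      _ ≤ C * (c ^ n * R) := by gcongr; exact h2.trans (by gcongr)
      _ = _ := by ring
  have hsumm : Summable fun n => C * R * c ^ n :=
    (summable_geometric_of_lt_one hc0.le hc2).mul_left _
  refine ⟨fun x => ∑' n, K (g^[n] x), ?_, ?_, ?_, R, hR, c, hc2, hc0.le, fun x hx => (hball x hx).1⟩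
  · refine aux_series hR (F := fun n x => K (g^[n] x)) (fun n => ?_) hbd hsumm
    intro x hx
    exact ((hball _ (hmaps.iterate n hx)).2.2.2).comp (hana n x hx)
  · have : ∀ n, g^[n] 0 = 0 := fun n => Function.iterate_fixed hg0 n
    simp [this, hK0]
  · filter_upwards [Metric.ball_mem_nhds (0:E) hR] with x hx
    have hs : Summable fun n => K (g^[n] x) := Summable.of_norm_bounded hsumm fun n => hbd n x hx
    rw [hs.tsum_eq_zero_add]
    rfl

lemma aux_solve {E : Type*} [NormedAddCommGroup E] [NormedSpace ℂ E] [CompleteSpace E]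
    {f : E → E} {K : E → ℂ} (hf : AnalyticAt ℂ f 0) (hf0 : f 0 = 0)
    (N : ℕ) (hA : ‖fderiv ℂ f 0 ^ N‖ < 1) (hK : AnalyticAt ℂ K 0) (hK0 : K 0 = 0) :
    ∃ S : E → ℂ, AnalyticAt ℂ S 0 ∧ S 0 = 0 ∧ (∀ᶠ x in nhds 0, S x = K x + S (f x)) := by
  have hfix : ∀ n, f^[n] 0 = 0 := fun n => Function.iterate_fixed hf0 n
  have hana : ∀ n, AnalyticAt ℂ (f^[n]) 0 := by
    intro n
    induction n with
    | zero => exact analyticAt_id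
    | succ n ih =>
      rw [Function.iterate_succ]
      exact AnalyticAt.comp (by rwa [hf0]) hf
  have hfd : fderiv ℂ (f^[N]) 0 = fderiv ℂ f 0 ^ N :=
    (HasFDerivAt.iterate hf.differentiableAt.hasFDerivAt hf0 N).fderiv
  set g := f^[N] with hg
  have hgt : Filter.Tendsto g (nhds 0) (nhds 0) := by
    have := (hana N).continuousAt.tendsto; rwa [hfix N] at this
  have hft : Filter.Tendsto f (nhds 0) (nhds 0) := by
    have := hf.continuousAt.tendsto; rwa [hf0] at this
  have hKg : AnalyticAt ℂ (fun x => ∑ j ∈ Finset.range N, K (f^[j] x)) 0 := by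
    refine Finset.analyticAt_fun_sum _ fun j _ => ?_
    exact AnalyticAt.fun_comp (by rwa [hfix j]) (hana j)
  obtain ⟨S, hS, hS0, hSeq, R, hR, c, hc1, hc0, hcon⟩ := aux_solve_contr (g := g) (hana N) (hfix N)
    (by rwa [hfd]) hKg (by simp [hfix, hK0])
  refine ⟨S, hS, hS0, ?_⟩
  set D : E → ℂ := fun x => K x + S (f x) - S x with hD
  have hDc : ContinuousAt D 0 := by
    have : AnalyticAt ℂ D 0 := (hK.add (AnalyticAt.fun_comp (by rwa [hf0]) hf)).sub hS
    exact this.continuousAt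
  have hDg : ∀ᶠ x in nhds 0, D x = D (g x) := by
    filter_upwards [hSeq, hft.eventually hSeq] with x h1 h2
    have h3 : g (f x) = f (g x) := by
      rw [hg, ← Function.iterate_succ_apply, Function.iterate_succ_apply']
    have h4 : ∑ j ∈ Finset.range N, K (f^[j] (f x)) + K x
        = ∑ j ∈ Finset.range N, K (f^[j] x) + K (g x) := by
      have a := Finset.sum_range_succ (fun j => K (f^[j] x)) N
      have b := Finset.sum_range_succ' (fun j => K (f^[j] x)) N
      simp only [Function.iterate_succ_apply, Function.iterate_zero, id] at a b
      rw [hg, ← a, b]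
    simp only [hD, h2, h3]
    rw [h1]
    linear_combination h4
  obtain ⟨R', hR', hball⟩ := Metric.eventually_nhds_iff_ball.1 hDg
  set r := min R R'
  filter_upwards [Metric.ball_mem_nhds (0:E) (lt_min hR hR')] with x hx
  have hmem : ∀ n, ‖g^[n] x‖ ≤ c ^ n * ‖x‖ ∧ D (g^[n] x) = D x := by
    intro n
    induction n with
    | zero => simp
    | succ n ih =>
      have hb : ‖g^[n] x‖ < min R R' := by
        have : c ^ n * ‖x‖ ≤ 1 * ‖x‖ := by gcongr; exact pow_le_one₀ hc0 hc1.le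
        simp only [Metric.mem_ball, dist_zero_right] at hx
        linarith [ih.1]
      rw [Function.iterate_succ_apply']
      constructor
      · calc _ ≤ c * ‖g^[n] x‖ := hcon _ (by simpa using (lt_min_iff.1 hb).1)
          _ ≤ c * (c ^ n * ‖x‖) := by gcongr; exact ih.1
          _ = _ := by ring
      · rw [← hball _ (by simpa using (lt_min_iff.1 hb).2), ih.2]
  have ht : Filter.Tendsto (fun n => g^[n] x) Filter.atTop (nhds 0) := by
    refine squeeze_zero_norm (fun n => (hmem n).1) ?_
    simpa using (tendsto_pow_atTop_nhds_zero_of_lt_one hc0 hc1).mul_const ‖x‖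
  have h1 := hDc.tendsto.comp ht
  have h2 : (D ∘ fun n => g^[n] x) = fun _ => D x := by
    funext n; exact (hmem n).2
  rw [h2] at h1
  have h3 := tendsto_nhds_unique tendsto_const_nhds h1
  have h4 : D 0 = 0 := by simp [hD, hK0, hf0]
  rw [h4] at h3
  simp only [hD] at h3
  linear_combination -h3

lemma aux_pow_lt {E : Type*} [NormedAddCommGroup E] [NormedSpace ℂ E] [CompleteSpace E]
    [FiniteDimensional ℂ E] [Nontrivial E] (A : E →L[ℂ] E)
    (h : ∀ c : ℂ, Module.End.HasEigenvalue A.toLinearMap c → ‖c‖ < 1) :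
    ∃ N : ℕ, ‖A ^ N‖ < 1 := by
  obtain ⟨z, hz, hzr⟩ := spectrum.exists_nnnorm_eq_spectralRadius A
  have hz1 : ‖z‖ < 1 := by
    apply h
    rw [Module.End.hasEigenvalue_iff_mem_spectrum]
    rw [spectrum.mem_iff] at hz ⊢
    contrapose! hz
    rw [ContinuousLinearMap.isUnit_iff_bijective]
    rw [Module.End.isUnit_iff] at hz
    exact hz
  have hlt : spectralRadius ℂ A < 1 := by
    rw [← hzr]; exact_mod_cast hz1
  have ht := spectrum.pow_nnnorm_pow_one_div_tendsto_nhds_spectralRadius A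
  obtain ⟨N, hN, hN1⟩ := ((ht.eventually (gt_mem_nhds hlt)).and (Filter.eventually_ge_atTop 1)).exists
  refine ⟨N, ?_⟩
  by_contra! hcon
  have : (1:ENNReal) ≤ (‖A ^ N‖₊ : ENNReal) := by exact_mod_cast hcon
  have h2 := ENNReal.one_le_rpow this (z := 1 / (N:ℝ)) (by positivity)
  exact absurd hN (not_lt.2 h2)

/-- iterated derivative in the last variable. -/
def auxDk {W : Type*} [NormedAddCommGroup W] [NormedSpace ℂ W] (χ : W × ℂ → ℂ) : ℕ → W × ℂ → ℂ
  | 0 => χ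
  | k + 1 => fun x => fderiv ℂ (auxDk χ k) x (0, 1)

lemma aux_vert {W : Type*} [NormedAddCommGroup W] [NormedSpace ℂ W] {G : W × ℂ → ℂ} {w : W} {t : ℂ}
    (hG : DifferentiableAt ℂ G (w, t)) :
    HasDerivAt (fun s => G (w, s)) (fderiv ℂ G (w, t) (0, 1)) t := by
  have h1 : HasDerivAt (fun s : ℂ => (w, s)) ((0:W), (1:ℂ)) t :=
    (hasDerivAt_const t w).prodMk (hasDerivAt_id t)
  exact HasFDerivAt.comp_hasDerivAt t hG.hasFDerivAt h1

lemma aux_prim {W : Type*} [NormedAddCommGroup W] [NormedSpace ℂ W]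
    {χ : W × ℂ → ℂ} (hχ : AnalyticAt ℂ χ 0) :
    ∃ ψ : W × ℂ → ℂ, AnalyticAt ℂ ψ 0 ∧ (∀ w, ψ (w, 0) = 0) ∧
      ∀ᶠ x in nhds (0 : W × ℂ), HasDerivAt (fun t => ψ (x.1, t)) (χ x) x.2 := by
  have hbdd : ∀ᶠ x in nhds (0 : W × ℂ), ‖χ x‖ ≤ ‖χ 0‖ + 1 := by
    have := hχ.continuousAt.norm.eventually (gt_mem_nhds (lt_add_one ‖χ 0‖))
    filter_upwards [this] with x hx using hx.le
  obtain ⟨R, hR, hball⟩ := Metric.eventually_nhds_iff_ball.1 (hbdd.and hχ.eventually_analyticAt)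
  set M := ‖χ 0‖ + 1 with hM
  have hM0 : 0 ≤ M := by positivity
  have hDk : ∀ k, AnalyticOnNhd ℂ (auxDk χ k) (Metric.ball 0 R) := by
    intro k
    induction k with
    | zero => exact fun x hx => (hball x hx).2
    | succ k ih =>
      intro x hx
      exact (ContinuousLinearMap.analyticAt (ContinuousLinearMap.apply ℂ ℂ ((0:W), (1:ℂ))) _).comp (ih.fderiv x hx)
  have hmem : ∀ (w : W) (t : ℂ), ‖w‖ < R → ‖t‖ < R → (w, t) ∈ Metric.ball (0 : W × ℂ) R := by
    intro w t hw ht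
    rw [mem_ball_zero_iff, Prod.norm_mk]
    exact max_lt hw ht
  have hitd : ∀ k (w : W) (t : ℂ), ‖w‖ < R → ‖t‖ < R →
      iteratedDeriv k (fun s => χ (w, s)) t = auxDk χ k (w, t) := by
    intro k w
    induction k with
    | zero => intro t _ _; simp [auxDk]
    | succ k ih =>
      intro t hw ht
      rw [iteratedDeriv_succ]
      have h1 : iteratedDeriv k (fun s => χ (w, s)) =ᶠ[nhds t] fun s => auxDk χ k (w, s) := by
        have : Metric.ball (0:ℂ) R ∈ nhds t := Metric.isOpen_ball.mem_nhds (by simpa using ht)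
        filter_upwards [this] with s hs using ih s hw (by simpa using hs)
      rw [h1.deriv_eq]
      exact (aux_vert (hDk k _ (hmem w t hw ht)).differentiableAt).deriv
  have hdiff : ∀ w : W, ‖w‖ < R → DifferentiableOn ℂ (fun s => χ (w, s)) (Metric.ball 0 R) := by
    intro w hw t ht
    exact (aux_vert (hball _ (hmem w t hw (by simpa using ht))).2.differentiableAt).differentiableAt.differentiableWithinAt
  have hcau : ∀ k (w : W), ‖w‖ < R → ‖auxDk χ k (w, 0)‖ ≤ k.factorial * M / (R/2) ^ k := by
    intro k w hw
    rw [← hitd k w 0 hw (by simpa using hR)]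
    apply Complex.norm_iteratedDeriv_le_of_forall_mem_sphere_norm_le k (by positivity)
    · apply DifferentiableOn.diffContOnCl
      rw [closure_ball _ (by positivity)]
      exact (hdiff w hw).mono (Metric.closedBall_subset_ball (by linarith))
    · intro z hz
      refine (hball _ (hmem w z hw ?_)).1
      simp at hz; linarith
  let F : ℕ → W × ℂ → ℂ := fun k x =>
    ((k.factorial : ℂ)⁻¹ * auxDk χ k (x.1, 0)) * (x.2 ^ (k+1) / ((k:ℂ) + 1))
  have hco : ∀ k (w : W), ‖w‖ < R → ‖(k.factorial : ℂ)⁻¹ * auxDk χ k (w, 0)‖ ≤ M / (R/2)^k := by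
    intro k w hw
    have hf : (0:ℝ) < k.factorial := by exact_mod_cast k.factorial_pos
    rw [norm_mul, norm_inv, Complex.norm_natCast]
    calc _ ≤ (k.factorial:ℝ)⁻¹ * (k.factorial * M / (R/2) ^ k) := by gcongr; exact hcau k w hw
      _ = _ := by field_simp
  have hn1 : ∀ k : ℕ, ((k:ℂ) + 1) ≠ 0 := fun k => by exact_mod_cast Nat.succ_ne_zero k
  have hsum4 : Summable fun k : ℕ => M * (1/2:ℝ)^k :=
    (summable_geometric_of_lt_one (by norm_num) (by norm_num)).mul_left _
  have hterm : ∀ k (w : W) (t : ℂ), ‖w‖ < R → ‖t‖ < R/4 →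
      ‖((k.factorial : ℂ)⁻¹ * auxDk χ k (w, 0)) * t ^ k‖ ≤ M * (1/2:ℝ)^k := by
    intro k w t hw ht
    rw [norm_mul, norm_pow]
    calc _ ≤ M / (R/2)^k * (R/4)^k := by gcongr; exact hco k w hw
      _ = M * (1/2:ℝ)^k := by
        rw [div_mul_eq_mul_div, mul_div_assoc, ← div_pow]; congr 2; field_simp; norm_num
  have hderF : ∀ k (w : W) (t : ℂ), HasDerivAt (fun s => F k (w, s))
      (((k.factorial : ℂ)⁻¹ * auxDk χ k (w, 0)) * t ^ k) t := by
    intro k w t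
    have h := ((hasDerivAt_pow (k+1) t).div_const ((k:ℂ)+1)).const_mul
      ((k.factorial : ℂ)⁻¹ * auxDk χ k (w, 0))
    refine h.congr_deriv ?_
    have := hn1 k
    push_cast
    field_simp
  refine ⟨fun x => ∑' k, F k x, ?_, ?_, ?_⟩
  · refine aux_series (R := R/4) (M := fun k => (R/4) * (M * (1/2:ℝ)^k)) (by positivity) ?_ ?_ (hsum4.mul_left _)
    · intro k x hx
      have hx' : ‖x.1‖ < R := by
        have := (norm_fst_le x); simp at hx; linarith
      have h1 : AnalyticAt ℂ (fun x : W × ℂ => auxDk χ k (x.1, 0)) x :=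
        AnalyticAt.fun_comp (f := fun x : W × ℂ => (x.1, (0:ℂ))) (hDk k _ (hmem _ _ hx' (by simpa using hR)))
          (analyticAt_fst.prod analyticAt_const)
      exact (analyticAt_const.mul h1).mul ((analyticAt_snd.pow (k+1)).div analyticAt_const (hn1 k))
    · rintro k ⟨w, t⟩ hx
      have h1 := norm_fst_le (w, t)
      have h2 := norm_snd_le (w, t)
      simp only [mem_ball_zero_iff] at hx h1 h2
      have h3 := hterm k w t (by linarith) (by linarith)
      have : F k (w, t) = (t / ((k:ℂ)+1)) * (((k.factorial : ℂ)⁻¹ * auxDk χ k (w, 0)) * t ^ k) := by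
        simp only [F]; ring
      rw [this, norm_mul]
      have h4 : ‖t / ((k:ℂ)+1)‖ ≤ R/4 := by
        rw [norm_div]
        have : ‖(k:ℂ)+1‖ = k + 1 := by exact_mod_cast Complex.norm_natCast (k+1)
        rw [this]
        exact (div_le_self (norm_nonneg _) (by linarith [(Nat.cast_nonneg k : (0:ℝ) ≤ k)])).trans (by linarith)
      gcongr
  · intro w; simp [F]
  · filter_upwards [Metric.ball_mem_nhds (0 : W × ℂ) (show 0 < R/4 by positivity)]
    rintro ⟨w, t⟩ hx
    have h1 := norm_fst_le (w, t)
    have h2 := norm_snd_le (w, t)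
    simp only [mem_ball_zero_iff] at hx h1 h2
    have h := hasDerivAt_tsum_of_isPreconnected (g := fun k s => F k (w, s))
      (g' := fun k s => ((k.factorial : ℂ)⁻¹ * auxDk χ k (w, 0)) * s ^ k) (t := Metric.ball (0:ℂ) (R/4))
      (y₀ := 0) (y := t) hsum4 Metric.isOpen_ball (convex_ball _ _).isPreconnected
      (fun k s _ => hderF k w s) (fun k s hs => hterm k w s (by linarith) (by simpa using hs))
      (by simpa using hR) (by simp [F, summable_zero]) (by rw [mem_ball_zero_iff]; linarith)
    have hT := Complex.hasSum_taylorSeries_on_ball (hdiff w (by linarith)) (z := t)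
      (by rw [mem_ball_zero_iff]; linarith)
    have hval : ∑' k : ℕ, ((k.factorial : ℂ)⁻¹ * auxDk χ k (w, 0)) * t ^ k = χ (w, t) := by
      rw [← hT.tsum_eq]
      congr 1; funext k
      rw [hitd k w 0 (by linarith) (by simpa using hR)]
      simp only [smul_eq_mul, sub_zero]; ring
    rw [hval] at h
    exact h

lemma aux_skew {W : Type*} [NormedAddCommGroup W] [NormedSpace ℂ W]
    {h : W → W} {Q ω : W → ℂ} {ε : W × ℂ → ℂ} {S : W × ℂ → ℂ}
    (hh : AnalyticAt ℂ h 0) (hh0 : h 0 = 0) (hQ : AnalyticAt ℂ Q 0)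
    (hω : AnalyticAt ℂ ω 0) (hω0 : ω 0 = 0)
    (hε : AnalyticAt ℂ ε 0) (hε0 : ε 0 = 0) (hS : AnalyticAt ℂ S 0) (hS0 : S 0 = 0)
    (hSeq : ∀ᶠ x in nhds (0 : W × ℂ), S x = Complex.log (1 + (ε x + x.2 * fderiv ℂ ε x (0, 1)))
      + S (h x.1, Q x.1 * x.2 * (1 + ε x) + ω x.1)) :
    ∃ ψ : W × ℂ → ℂ, AnalyticAt ℂ ψ 0 ∧ ψ 0 = 0 ∧
      HasFDerivAt ψ (ContinuousLinearMap.snd ℂ W ℂ) 0 ∧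
      ∀ᶠ x in nhds (0 : W × ℂ), ψ (h x.1, Q x.1 * x.2 * (1 + ε x) + ω x.1)
        = Q x.1 * ψ x + ψ (h x.1, ω x.1) := by
  set F : W × ℂ → W × ℂ := fun x => (h x.1, Q x.1 * x.2 * (1 + ε x) + ω x.1) with hF
  have hfst : AnalyticAt ℂ (fun x : W × ℂ => x.1) 0 := analyticAt_fst
  have hsnd : AnalyticAt ℂ (fun x : W × ℂ => x.2) 0 := analyticAt_snd
  have hFa : AnalyticAt ℂ F 0 := by
    refine AnalyticAt.prod (AnalyticAt.fun_comp (g := h) hh hfst) ?_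
    refine AnalyticAt.add (AnalyticAt.mul (AnalyticAt.mul (AnalyticAt.fun_comp (g := Q) hQ hfst) hsnd)
      (analyticAt_const.add hε)) (AnalyticAt.fun_comp (g := ω) hω hfst)
  have hF0 : F 0 = 0 := by simp [hF, hh0, hω0]
  have hFt : Filter.Tendsto F (nhds 0) (nhds 0) := by
    have := hFa.continuousAt.tendsto; rwa [hF0] at this
  set εt : W × ℂ → ℂ := fun x => ε x + x.2 * fderiv ℂ ε x (0, 1) with hεt
  have hεta : AnalyticAt ℂ εt 0 := by
    refine hε.add (hsnd.mul ?_)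
    exact (ContinuousLinearMap.analyticAt (ContinuousLinearMap.apply ℂ ℂ ((0:W), (1:ℂ))) _).comp hε.fderiv
  have hεt0 : εt 0 = 0 := by simp [hεt, hε0]
  set χ : W × ℂ → ℂ := fun x => Complex.exp (S x) with hχ
  have hχa : AnalyticAt ℂ χ 0 := hS.cexp
  have hχ0 : χ 0 = 1 := by simp [hχ, hS0]
  have hne : ∀ᶠ x in nhds (0 : W × ℂ), 1 + εt x ≠ 0 := by
    have : ContinuousAt (fun x => 1 + εt x) 0 := (analyticAt_const.add hεta).continuousAt
    exact this.eventually_ne (by simp [hεt0])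
  have hχeq : ∀ᶠ x in nhds (0 : W × ℂ), χ x = (1 + εt x) * χ (F x) := by
    filter_upwards [hSeq, hne] with x h1 h2
    simp only [hχ]
    rw [h1, Complex.exp_add, Complex.exp_log h2]
  obtain ⟨ψ, hψ, hψ0, hψd⟩ := aux_prim hχa
  have hψ00 : ψ 0 = 0 := hψ0 0
  refine ⟨ψ, hψ, hψ00, ?_, ?_⟩
  · have h1 := hψ.differentiableAt.hasFDerivAt
    have h2 : fderiv ℂ ψ 0 = ContinuousLinearMap.snd ℂ W ℂ := by
      have hv : fderiv ℂ ψ 0 (0, 1) = 1 := by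
        have := (aux_vert (G := ψ) (w := 0) (t := 0) hψ.differentiableAt).unique hψd.self_of_nhds
        rw [hχ0] at this; exact this
      have hw : ∀ w : W, fderiv ℂ ψ 0 (w, 0) = 0 := by
        intro w
        have h3 : HasFDerivAt (fun w : W => ψ (w, 0)) ((fderiv ℂ ψ 0).comp (ContinuousLinearMap.inl ℂ W ℂ)) 0 :=
          HasFDerivAt.comp (g := ψ) (f := ContinuousLinearMap.inl ℂ W ℂ) (0:W)
            h1 (ContinuousLinearMap.inl ℂ W ℂ).hasFDerivAt
        have h4 : HasFDerivAt (fun w : W => ψ (w, 0)) (0 : W →L[ℂ] ℂ) 0 := by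
          simp only [hψ0]; exact hasFDerivAt_const _ _
        have := congrArg (fun A : W →L[ℂ] ℂ => A w) (h3.unique h4)
        simpa using this
      ext x
      · simpa using hw x
      · simpa using hv
    rwa [h2] at h1
  · obtain ⟨R, hR, hball⟩ := Metric.eventually_nhds_iff_ball.1
      (hχeq.and (hψd.and ((hFt.eventually hψd).and (hε.eventually_analyticAt))))
    filter_upwards [Metric.ball_mem_nhds _ hR]
    rintro ⟨w, z⟩ hx
    have h1 := norm_fst_le (w, z)
    have h2 := norm_snd_le (w, z)
    simp only [mem_ball_zero_iff] at hx h1 h2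
    have hder : ∀ t ∈ Metric.ball (0:ℂ) R,
        HasDerivAt (fun t => ψ (F (w, t)) - Q w * ψ (w, t)) 0 t := by
      intro t ht
      obtain ⟨e1, e2, e3, e4⟩ := hball (w, t) (by
        rw [mem_ball_zero_iff, Prod.norm_mk]; exact max_lt (by linarith) (by simpa using ht))
      have d1 := aux_vert (G := ε) e4.differentiableAt
      have d2 : HasDerivAt (fun t => Q w * t * (1 + ε (w, t)) + ω w) (Q w * (1 + εt (w, t))) t := by
        have := ((((hasDerivAt_id t).const_mul (Q w)).mul (d1.const_add 1)).add_const (ω w))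
        refine this.congr_deriv ?_
        simp only [hεt, id]; ring
      have d3 : HasDerivAt (fun t => ψ (F (w, t))) (χ (F (w, t)) * (Q w * (1 + εt (w, t)))) t :=
        HasDerivAt.comp (h₂ := fun s => ψ (h w, s)) t e3 d2
      have d4 := d3.sub (e2.const_mul (Q w))
      refine d4.congr_deriv ?_
      rw [e1]; ring
    have hc := IsOpen.is_const_of_deriv_eq_zero Metric.isOpen_ball (convex_ball (0:ℂ) R).isPreconnected
      (fun t ht => (hder t ht).differentiableAt.differentiableWithinAt) (fun t ht => (hder t ht).deriv)
      (x := z) (y := 0) (by rw [mem_ball_zero_iff]; linarith) (by simpa using hR)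
    simp only [hψ0, mul_zero, sub_zero] at hc
    have h5 : F (w, 0) = (h w, ω w) := by simp [hF]
    rw [h5] at hc
    show ψ (F (w, z)) = Q w * ψ (w, z) + ψ (h w, ω w)
    linear_combination hc

/-- Theorem on rigid germs with `s + p = d - 1`: a contracting holomorphic
germ of the form
`f(x,y,z) = (γ x^P + σ(x), β x^E y^D (1+g(x)), ν x^l y^m z (1+ε(x,y,z)) + ω(x,y))`
with `x = (u,v)`, `γ = (α,μ)`, `P = B ⊕ Id`, `det D ≠ 0`, `(l,m) ≠ (0,0)`,
`σ = (0,ρ)` primary resonant polynomial and `g` secondary resonant polynomial,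
is holomorphically conjugated to
`f̃(x,y,z) = (γ x^P + σ(x), β x^E y^D (1+g(x)), ν x^l y^m z + ω̃(x,y))`. -/
theorem stmt_4 (r e p : ℕ)
    (f : SpZ r e p → SpZ r e p)
    (α : Fin r → ℂ) (μ : Fin e → ℂ) (β : Fin p → ℂ) (ν : ℂ)
    (B : Matrix (Fin r) (Fin r) ℕ) (τ : Equiv.Perm (Fin r))
    (E : Matrix (Fin r ⊕ Fin e) (Fin p) ℕ) (D : Matrix (Fin p) (Fin p) ℕ)
    (l : (Fin r ⊕ Fin e) → ℕ) (m : Fin p → ℕ)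
    (ρ : Fin e → MvPolynomial (Fin r ⊕ Fin e) ℂ)
    (g : Fin p → MvPolynomial (Fin r ⊕ Fin e) ℂ)
    (ε : SpZ r e p → ℂ)
    (ω : (Fin r → ℂ) × (Fin e → ℂ) × (Fin p → ℂ) → ℂ)
    (hα : ∀ i, α i ≠ 0) (hμ : ∀ i, 0 < ‖μ i‖ ∧ ‖μ i‖ < 1) (hβ : ∀ i, β i ≠ 0)
    (hν : ν ≠ 0)
    (hB : ∀ l' i, B l' i = if l' = τ i then 1 else 0)
    (hD : (D.map (Nat.cast : ℕ → ℂ)).det ≠ 0)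
    (hlm : ¬ (l = 0 ∧ m = 0))
    (hρ0 : ∀ kk : Fin e, MvPolynomial.coeff 0 (ρ kk) = 0)
    -- every monomial of ρ is primary resonant
    (hρres : ∀ (kk : Fin e) (n : (Fin r ⊕ Fin e) →₀ ℕ),
      MvPolynomial.coeff n (ρ kk) ≠ 0 →
        (∏ i, (∏ jj ∈ Finset.range (orderOf τ), α ((τ ^ jj) i)) ^ n (Sum.inl i)) *
            (∏ i, μ i ^ (orderOf τ * n (Sum.inr i)))
          = μ kk ^ orderOf τ)
    (hg0 : ∀ i : Fin p, MvPolynomial.coeff 0 (g i) = 0)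
    -- every monomial of g is secondary resonant
    (hgres : ∀ (i : Fin p) (n : (Fin r ⊕ Fin e) →₀ ℕ),
      MvPolynomial.coeff n (g i) ≠ 0 →
        ((D.map (Nat.cast : ℕ → ℂ)) ^ orderOf (Equiv.sumCongr τ (Equiv.refl (Fin e)))
            - (∏ kk : Fin r ⊕ Fin e,
                (∏ jj ∈ Finset.range (orderOf (Equiv.sumCongr τ (Equiv.refl (Fin e)))),
                  Sum.elim α μ ((Equiv.sumCongr τ (Equiv.refl (Fin e)) ^ jj) kk)) ^ n kk)
              • (1 : Matrix (Fin p) (Fin p) ℂ)).det = 0)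
    (hεa : AnalyticAt ℂ ε 0) (hε0 : ε 0 = 0)
    (hωa : AnalyticAt ℂ ω 0) (hω0 : ω 0 = 0)
    (hf : ∀ u v y z, f (u, v, y, z) =
      (fun i => α i * ∏ l', u l' ^ B l' i,
       fun i => μ i * v i + MvPolynomial.eval (Sum.elim u v) (ρ i),
       fun i => β i * ((∏ l', u l' ^ E (Sum.inl l') i) * ∏ l', v l' ^ E (Sum.inr l') i)
           * (∏ l', y l' ^ D l' i)
           * (1 + MvPolynomial.eval (Sum.elim u v) (g i)),
       ν * ((∏ i, u i ^ l (Sum.inl i)) * ∏ i, v i ^ l (Sum.inr i))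
           * (∏ i, y i ^ m i) * z * (1 + ε (u, v, y, z))
         + ω (u, v, y)))
    (hcontr : ∀ c : ℂ,
      Module.End.HasEigenvalue (fderiv ℂ f 0).toLinearMap c → ‖c‖ < 1) :
    ∃ ω' : (Fin r → ℂ) × (Fin e → ℂ) × (Fin p → ℂ) → ℂ,
      AnalyticAt ℂ ω' 0 ∧ ω' 0 = 0 ∧
      ∃ (Φ : SpZ r e p → SpZ r e p) (L : SpZ r e p ≃L[ℂ] SpZ r e p),
        AnalyticAt ℂ Φ 0 ∧ Φ 0 = 0 ∧
        HasFDerivAt Φ (L : SpZ r e p →L[ℂ] SpZ r e p) 0 ∧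
        ∀ᶠ x in nhds (0 : SpZ r e p), Φ (f x) =
          (fun w : SpZ r e p =>
            (fun i => α i * ∏ l', w.1 l' ^ B l' i,
             fun i => μ i * w.2.1 i + MvPolynomial.eval (Sum.elim w.1 w.2.1) (ρ i),
             fun i => β i
                 * ((∏ l', w.1 l' ^ E (Sum.inl l') i) * ∏ l', w.2.1 l' ^ E (Sum.inr l') i)
                 * (∏ l', w.2.2.1 l' ^ D l' i)
                 * (1 + MvPolynomial.eval (Sum.elim w.1 w.2.1) (g i)),
             ν * ((∏ i, w.1 i ^ l (Sum.inl i)) * ∏ i, w.2.1 i ^ l (Sum.inr i))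
                 * (∏ i, w.2.2.1 i ^ m i) * w.2.2.2
               + ω' (w.1, w.2.1, w.2.2.1))) (Φ x) := by
  classical
  let W := (Fin r → ℂ) × (Fin e → ℂ) × (Fin p → ℂ)
  let T : SpZ r e p →L[ℂ] W × ℂ :=
    ((ContinuousLinearMap.fst ℂ _ _).prod
      (((ContinuousLinearMap.fst ℂ _ _).comp (ContinuousLinearMap.snd ℂ _ _)).prod
        ((ContinuousLinearMap.fst ℂ _ _).comp ((ContinuousLinearMap.snd ℂ _ _).comp
          (ContinuousLinearMap.snd ℂ _ _))))).prod
      ((ContinuousLinearMap.snd ℂ _ _).comp ((ContinuousLinearMap.snd ℂ _ _).comp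
          (ContinuousLinearMap.snd ℂ _ _)))
  let Ti : W × ℂ →L[ℂ] SpZ r e p :=
    ((ContinuousLinearMap.fst ℂ _ _).comp (ContinuousLinearMap.fst ℂ _ _)).prod
      (((ContinuousLinearMap.fst ℂ _ _).comp ((ContinuousLinearMap.snd ℂ _ _).comp
          (ContinuousLinearMap.fst ℂ _ _))).prod
        (((ContinuousLinearMap.snd ℂ _ _).comp ((ContinuousLinearMap.snd ℂ _ _).comp
          (ContinuousLinearMap.fst ℂ _ _))).prod (ContinuousLinearMap.snd ℂ _ _)))
  have hT : ∀ x, T x = ((x.1, x.2.1, x.2.2.1), x.2.2.2) := fun x => rfl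
  have hTi : ∀ x, Ti x = (x.1.1, x.1.2.1, x.1.2.2, x.2) := fun x => rfl
  have hTTi : ∀ x, T (Ti x) = x := fun x => rfl
  have hT0 : T 0 = 0 := map_zero T
  have hTi0 : Ti 0 = 0 := map_zero Ti
  let h : W → W := fun w =>
    (fun i => α i * ∏ l', w.1 l' ^ B l' i,
     fun i => μ i * w.2.1 i + MvPolynomial.eval (Sum.elim w.1 w.2.1) (ρ i),
     fun i => β i
         * ((∏ l', w.1 l' ^ E (Sum.inl l') i) * ∏ l', w.2.1 l' ^ E (Sum.inr l') i)
         * (∏ l', w.2.2 l' ^ D l' i)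
         * (1 + MvPolynomial.eval (Sum.elim w.1 w.2.1) (g i)))
  let Q : W → ℂ := fun w => ν * ((∏ i, w.1 i ^ l (Sum.inl i)) * ∏ i, w.2.1 i ^ l (Sum.inr i))
                 * (∏ i, w.2.2 i ^ m i)
  have c1 : ∀ i, AnalyticAt ℂ (fun w : W => w.1 i) 0 := fun i =>
    ContinuousLinearMap.analyticAt ((ContinuousLinearMap.proj (R := ℂ) (φ := fun _ : Fin r => ℂ) i).comp
      (ContinuousLinearMap.fst ℂ (Fin r → ℂ) ((Fin e → ℂ) × (Fin p → ℂ))) : W →L[ℂ] ℂ) 0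
  have c2 : ∀ i, AnalyticAt ℂ (fun w : W => w.2.1 i) 0 := fun i =>
    ContinuousLinearMap.analyticAt ((ContinuousLinearMap.proj (R := ℂ) (φ := fun _ : Fin e => ℂ) i).comp
      ((ContinuousLinearMap.fst ℂ (Fin e → ℂ) (Fin p → ℂ)).comp
        (ContinuousLinearMap.snd ℂ (Fin r → ℂ) ((Fin e → ℂ) × (Fin p → ℂ)))) : W →L[ℂ] ℂ) 0
  have c3 : ∀ i, AnalyticAt ℂ (fun w : W => w.2.2 i) 0 := fun i =>
    ContinuousLinearMap.analyticAt ((ContinuousLinearMap.proj (R := ℂ) (φ := fun _ : Fin p => ℂ) i).comp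
      ((ContinuousLinearMap.snd ℂ (Fin e → ℂ) (Fin p → ℂ)).comp
        (ContinuousLinearMap.snd ℂ (Fin r → ℂ) ((Fin e → ℂ) × (Fin p → ℂ)))) : W →L[ℂ] ℂ) 0
  have m1 : ∀ n : Fin r → ℕ, AnalyticAt ℂ (fun w : W => ∏ i, w.1 i ^ n i) 0 := fun n =>
    Finset.analyticAt_fun_prod _ fun i _ => (c1 i).pow (n i)
  have m2 : ∀ n : Fin e → ℕ, AnalyticAt ℂ (fun w : W => ∏ i, w.2.1 i ^ n i) 0 := fun n =>
    Finset.analyticAt_fun_prod _ fun i _ => (c2 i).pow (n i)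
  have m3 : ∀ n : Fin p → ℕ, AnalyticAt ℂ (fun w : W => ∏ i, w.2.2 i ^ n i) 0 := fun n =>
    Finset.analyticAt_fun_prod _ fun i _ => (c3 i).pow (n i)
  have mp : ∀ P : MvPolynomial (Fin r ⊕ Fin e) ℂ,
      AnalyticAt ℂ (fun w : W => MvPolynomial.eval (Sum.elim w.1 w.2.1) P) 0 := by
    intro P
    have := AnalyticAt.aeval_mvPolynomial (𝕜 := ℂ) (f := fun w : W => Sum.elim w.1 w.2.1) (z := 0)
      (by rintro (i | i); exacts [c1 i, c2 i]) P
    have he : ∀ x : (Fin r ⊕ Fin e) → ℂ, MvPolynomial.eval x P = MvPolynomial.aeval x P := fun x => by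
      rw [MvPolynomial.aeval_def, MvPolynomial.eval, Algebra.algebraMap_self]; rfl
    simp only [he]
    exact this
  have hha : AnalyticAt ℂ h 0 := by
    refine AnalyticAt.prod ?_ (AnalyticAt.prod ?_ ?_)
    · exact analyticAt_pi_iff.2 fun i => analyticAt_const.mul (m1 fun l' => B l' i)
    · exact analyticAt_pi_iff.2 fun i => (analyticAt_const.mul (c2 i)).add (mp (ρ i))
    · exact analyticAt_pi_iff.2 fun i => ((analyticAt_const.mul ((m1 _).mul (m2 _))).mul (m3 fun l' => D l' i)).mul
        (analyticAt_const.add (mp (g i)))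
  have hQa : AnalyticAt ℂ Q 0 := (analyticAt_const.mul ((m1 _).mul (m2 _))).mul (m3 _)
  have hpol0 : ∀ P : MvPolynomial (Fin r ⊕ Fin e) ℂ, MvPolynomial.coeff 0 P = 0 →
      MvPolynomial.eval (Sum.elim (0 : Fin r → ℂ) (0 : Fin e → ℂ)) P = 0 := by
    intro P hP
    have h0 : (Sum.elim (0 : Fin r → ℂ) (0 : Fin e → ℂ)) = 0 := by
      funext i; cases i <;> rfl
    rw [h0, MvPolynomial.eval_zero, MvPolynomial.constantCoeff_eq, hP]
  have hh0 : h 0 = 0 := by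
    refine Prod.ext ?_ (Prod.ext ?_ ?_)
    · funext i
      show α i * ∏ l', (0:ℂ) ^ B l' i = 0
      rw [Finset.prod_eq_zero (Finset.mem_univ (τ i)), mul_zero]
      simp [hB]
    · funext i
      show μ i * 0 + MvPolynomial.eval (Sum.elim (0 : Fin r → ℂ) (0 : Fin e → ℂ)) (ρ i) = 0
      rw [hpol0 _ (hρ0 i)]; simp
    · funext i
      have hcol : ∃ k, D k i ≠ 0 := by
        by_contra! hcon
        exact hD (Matrix.det_eq_zero_of_column_eq_zero i (fun k => by simp [hcon k]))
      obtain ⟨k, hk⟩ := hcol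
      show β i * ((∏ l', (0:ℂ) ^ E (Sum.inl l') i) * ∏ l', (0:ℂ) ^ E (Sum.inr l') i)
         * (∏ l', (0:ℂ) ^ D l' i)
         * (1 + MvPolynomial.eval (Sum.elim (0 : Fin r → ℂ) (0 : Fin e → ℂ)) (g i)) = 0
      rw [Finset.prod_eq_zero (s := Finset.univ) (f := fun l' => (0:ℂ) ^ D l' i) (Finset.mem_univ k) (by simp [hk])]
      simp
  let ε' : W × ℂ → ℂ := fun x => ε (Ti x)
  have hε'a : AnalyticAt ℂ ε' 0 := AnalyticAt.fun_comp (g := ε) (by rwa [hTi0]) (Ti.analyticAt 0)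
  have hε'0 : ε' 0 = 0 := by show ε (Ti 0) = 0; rw [hTi0, hε0]
  let F : W × ℂ → W × ℂ := fun x => (h x.1, Q x.1 * x.2 * (1 + ε' x) + ω x.1)
  have hfF : ∀ x, f x = Ti (F (T x)) := by
    rintro ⟨u, v, y, z⟩
    rw [hf]
    rfl
  have hFa : AnalyticAt ℂ F 0 := by
    have hfst : AnalyticAt ℂ (fun x : W × ℂ => x.1) 0 := analyticAt_fst
    refine AnalyticAt.prod (AnalyticAt.fun_comp (g := h) hha hfst) ?_
    exact AnalyticAt.add (AnalyticAt.mul (AnalyticAt.mul (AnalyticAt.fun_comp (g := Q) hQa hfst) analyticAt_snd)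
      (analyticAt_const.add hε'a)) (AnalyticAt.fun_comp (g := ω) hωa hfst)
  have hF0 : F 0 = 0 := by
    refine Prod.ext hh0 ?_
    show Q 0 * 0 * (1 + ε' 0) + ω 0 = 0
    rw [hω0]; simp
  have hfa : AnalyticAt ℂ f 0 := by
    have : f = fun x => Ti (F (T x)) := funext hfF
    rw [this]
    exact AnalyticAt.fun_comp (g := Ti) (Ti.analyticAt _)
      (AnalyticAt.fun_comp (g := F) (by rwa [hT0]) (T.analyticAt 0))
  have hf0 : f 0 = 0 := by rw [hfF, hT0, hF0, hTi0]
  let K' : W × ℂ → ℂ := fun x => Complex.log (1 + (ε' x + x.2 * fderiv ℂ ε' x (0, 1)))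
  have hK'a : AnalyticAt ℂ K' 0 := by
    refine AnalyticAt.clog (analyticAt_const.add (hε'a.add (analyticAt_snd.mul ?_))) ?_
    · exact (ContinuousLinearMap.analyticAt (ContinuousLinearMap.apply ℂ ℂ ((0:W), (1:ℂ))) _).comp hε'a.fderiv
    · simp [hε'0]
  have hK'0 : K' 0 = 0 := by simp [K', hε'0]
  obtain ⟨N, hN⟩ := aux_pow_lt (fderiv ℂ f 0) hcontr
  obtain ⟨S, hS, hS0, hSeq⟩ := aux_solve (K := fun x => K' (T x)) hfa hf0 N hN
    (AnalyticAt.fun_comp (g := K') (by rwa [hT0]) (T.analyticAt 0)) (by rw [hT0, hK'0])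
  have hTit : Filter.Tendsto Ti (nhds 0) (nhds 0) := by
    have := Ti.continuous.tendsto 0; rwa [hTi0] at this
  have hTt : Filter.Tendsto T (nhds 0) (nhds 0) := by
    have := T.continuous.tendsto 0; rwa [hT0] at this
  obtain ⟨ψ, hψ, hψ0, hψd, hψeq⟩ := aux_skew (S := fun x => S (Ti x)) hha hh0 hQa hωa hω0 hε'a hε'0
    (AnalyticAt.fun_comp (g := S) (by rwa [hTi0]) (Ti.analyticAt 0)) (by rw [hTi0, hS0]) (by
      filter_upwards [hTit.eventually hSeq] with x hx
      rw [hx, hfF]; rfl)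
  refine ⟨fun w => ψ (h w, ω w), ?_, ?_, fun x => Ti ((T x).1, ψ (T x)), ContinuousLinearEquiv.refl ℂ _, ?_, ?_, ?_, ?_⟩
  · refine AnalyticAt.fun_comp (g := ψ) (f := fun w => (h w, ω w)) ?_ (hha.prod hωa)
    rw [hh0, hω0]; exact hψ
  · show ψ (h 0, ω 0) = 0
    rw [hh0, hω0]; exact hψ0
  · refine AnalyticAt.fun_comp (g := Ti) (Ti.analyticAt _) ?_
    refine AnalyticAt.prod ?_ ?_
    · exact ((ContinuousLinearMap.fst ℂ _ _).comp T).analyticAt 0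
    · exact AnalyticAt.fun_comp (g := ψ) (by rwa [hT0]) (T.analyticAt 0)
  · show Ti ((T 0).1, ψ (T 0)) = 0
    rw [hT0, hψ0]; exact hTi0
  · have d1 : HasFDerivAt (fun x => ψ (T x)) ((ContinuousLinearMap.snd ℂ W ℂ).comp T) 0 :=
      HasFDerivAt.comp (g := ψ) (0 : SpZ r e p) (by rwa [hT0]) T.hasFDerivAt
    have d2 : HasFDerivAt (fun x => (T x).1) ((ContinuousLinearMap.fst ℂ W ℂ).comp T) 0 :=
      ((ContinuousLinearMap.fst ℂ W ℂ).comp T).hasFDerivAt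
    exact HasFDerivAt.comp (g := Ti) (0 : SpZ r e p) Ti.hasFDerivAt (d2.prodMk d1)
  · filter_upwards [hTt.eventually hψeq] with x hx
    have h1 : T (f x) = F (T x) := by rw [hfF, hTTi]
    show Ti ((T (f x)).1, ψ (T (f x))) = Ti (h (T x).1, Q (T x).1 * ψ (T x) + ψ (h (T x).1, ω (T x).1))
    rw [h1]
    show Ti (h (T x).1, ψ (F (T x))) = _
    rw [← hx]

end
end

section
/- Let d ≥ 1, 1 ≤ b, 0 ≤ c ≤ d − b, let ψ¹,…,ψᵇ ∈ ℂ[[x₁,…,x_d]] be formal power series, and let j ∈ ℕ^b. Suppose that for every k = 1,…,b the coefficients satisfy ψᵏ_n = 0 for every multi-index n ∈ ℕ^d with n < e^{c+k} in the degree-lexicographic total order. Then for every matrix of indices H = (h^{k,l})_{1≤k≤b, 1≤l≤j_k} one has ψ_H = 0 whenever |H| < (0_c, j, 0_{d−c−b}). If, moreover, ψᵏ_{e^{c+k}} = 0 for every k = 1,…,b, then ψ_H = 0 whenever j ≠ 0 and |H| ≤ (0_c, j, 0_{d−c−b}). -/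
/-- The degree-lexicographic strict order on multi-indices in `ℕ^d`:
`m < n` iff `(|m|, m₁, …, m_d)` precedes `(|n|, n₁, …, n_d)` lexicographically. -/
def DegLexLt {d : ℕ} (m n : Fin d → ℕ) : Prop :=
  (∑ i, m i) < (∑ i, n i) ∨
    ((∑ i, m i) = (∑ i, n i) ∧
      ∃ i : Fin d, (∀ i' : Fin d, i' < i → m i' = n i') ∧ m i < n i)

def degLexKey (d : ℕ) : (Fin d → ℕ) →+ (ℕ ×ₗ Lex (Fin d → ℕ)) where
  toFun m := toLex (∑ i, m i, toLex m)
  map_zero' := by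
    simp
  map_add' m n := by
    simp only [Pi.add_apply, Finset.sum_add_distrib]; rfl

theorem degLexLt_iff_key {d : ℕ} (m n : Fin d → ℕ) :
    DegLexLt m n ↔ degLexKey d m < degLexKey d n := by
  change _ ↔ toLex (∑ i, m i, toLex m) < toLex (∑ i, n i, toLex n)
  rw [Prod.Lex.toLex_lt_toLex]
  exact Iff.rfl

theorem key_le_of_ne {d : ℕ} {m n : Fin d → ℕ} (h : ¬ DegLexLt m n) :
    degLexKey d n ≤ degLexKey d m := by
  rw [degLexLt_iff_key] at h
  exact not_lt.mp h

theorem degLexKey_inj {d : ℕ} {m n : Fin d → ℕ} (h : degLexKey d m = degLexKey d n) :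
    m = n := by
  have h2 : toLex (∑ i, m i, toLex m) = toLex (∑ i, n i, toLex n) := h
  have h3 := congrArg (fun x => ofLex (ofLex x).2) h2
  exact h3

/-- Lemma on matrices of indices: if `ψᵏ_n = 0` for all `n < e^{c+k}`
(degree-lex), then `ψ_H = 0` whenever `|H| < (0_c, j, 0_{d-c-b})`; if moreover
`ψᵏ_{e^{c+k}} = 0` for all `k`, then `ψ_H = 0` whenever `j ≠ 0` and
`|H| ≤ (0_c, j, 0_{d-c-b})`. Here `ψ_H = ∏_{k,l} ψᵏ_{h^{k,l}}` and
`|H| = ∑_{k,l} h^{k,l}`. -/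
theorem stmt_7 (d b c : ℕ) (hd : 1 ≤ d) (hb : 1 ≤ b) (hcb : c + b ≤ d)
    (ψ : Fin b → (Fin d → ℕ) → ℂ) (j : Fin b → ℕ)
    (hψ : ∀ (k : Fin b) (n : Fin d → ℕ),
      DegLexLt n (fun i => if i.val = c + k.val then 1 else 0) → ψ k n = 0) :
    (∀ H : (k : Fin b) → Fin (j k) → (Fin d → ℕ),
        DegLexLt (fun i => ∑ k, ∑ l, H k l i)
          (fun i : Fin d => ∑ k : Fin b, if i.val = c + k.val then j k else 0) →
        (∏ k, ∏ l, ψ k (H k l)) = 0) ∧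
      ((∀ k : Fin b, ψ k (fun i => if i.val = c + k.val then 1 else 0) = 0) →
        j ≠ 0 →
        ∀ H : (k : Fin b) → Fin (j k) → (Fin d → ℕ),
          (DegLexLt (fun i => ∑ k, ∑ l, H k l i)
              (fun i : Fin d => ∑ k : Fin b, if i.val = c + k.val then j k else 0) ∨
            (fun i : Fin d => ∑ k, ∑ l, H k l i)
              = (fun i : Fin d => ∑ k : Fin b, if i.val = c + k.val then j k else 0)) →
          (∏ k, ∏ l, ψ k (H k l)) = 0) := by
  have e1 : ∀ H : (k : Fin b) → Fin (j k) → (Fin d → ℕ),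
      degLexKey d (fun i => ∑ k, ∑ l, H k l i) = ∑ k, ∑ l, degLexKey d (H k l) := by
    intro H
    simp only [← map_sum]
    congr 1
    ext i
    simp
  have e2 : degLexKey d (fun i : Fin d => ∑ k : Fin b, if i.val = c + k.val then j k else 0)
      = ∑ k : Fin b, ∑ _l : Fin (j k),
        degLexKey d (fun i => if i.val = c + k.val then 1 else 0) := by
    simp only [← map_sum]
    congr 1
    ext i
    simp
  constructor
  · intro H hH
    by_contra hne
    rw [degLexLt_iff_key, e1, e2] at hH
    refine absurd hH (not_lt.mpr ?_)
    refine Finset.sum_le_sum fun k _ => Finset.sum_le_sum fun l _ => key_le_of_ne fun h => ?_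
    exact hne (Finset.prod_eq_zero (Finset.mem_univ k)
      (Finset.prod_eq_zero (Finset.mem_univ l) (hψ k _ h)))
  · intro h0 hj H hH
    by_contra hne
    have hle : degLexKey d (fun i => ∑ k, ∑ l, H k l i) ≤ degLexKey d
        (fun i : Fin d => ∑ k : Fin b, if i.val = c + k.val then j k else 0) := by
      rcases hH with hH | hH
      · exact ((degLexLt_iff_key _ _).mp hH).le
      · rw [hH]
    rw [e1, e2] at hle
    have hlt : ∀ (k : Fin b) (l : Fin (j k)),
        degLexKey d (fun i => if i.val = c + k.val then 1 else 0) < degLexKey d (H k l) := by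
      intro k l
      have hn : ψ k (H k l) ≠ 0 := fun h =>
        hne (Finset.prod_eq_zero (Finset.mem_univ k)
          (Finset.prod_eq_zero (Finset.mem_univ l) h))
      refine lt_of_le_of_ne (key_le_of_ne fun h => hn (hψ k _ h)) fun h => hn ?_
      rw [← degLexKey_inj h]
      exact h0 k
    obtain ⟨k0, hk0⟩ := Function.ne_iff.mp hj
    have hpos : 0 < j k0 := Nat.pos_of_ne_zero hk0
    refine absurd hle (not_le.mpr ?_)
    refine Finset.sum_lt_sum (fun k _ => Finset.sum_le_sum fun l _ => (hlt k l).le)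
      ⟨k0, Finset.mem_univ _, ?_⟩
    exact Finset.sum_lt_sum_of_nonempty ⟨⟨0, hpos⟩, Finset.mem_univ _⟩ fun l _ => hlt k0 l
end

section
/- Let η ≥ 1 and p ≥ 1 be integers, let D be a p×p complex matrix with det D ≠ 0, and let c_0, …, c_{η−1} ∈ ℂ* be nonzero complex numbers. Let M be the (ηp)×(ηp) complex matrix, with rows and columns indexed by pairs (i,a) ∈ (ℤ/ηℤ) × {1,…,p}, defined by M_{(i,a),(j,b)} = −[i = j]·D_{a,b} + [i = j + 1 (mod η)]·c_j·[a = b] (i.e. M has blocks −D on the diagonal and c_j·Id_p in the block position (j+1 mod η, j)). Then M is invertible if and only if ∏_{j=0}^{η−1} c_j is not an eigenvalue of the matrix D^η. -/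
open Matrix in
lemma aux_prod (η : ℕ) [NeZero η] (f : ZMod η → ℂ) :
    ∏ i ∈ Finset.range η, f (i : ZMod η) = ∏ x, f x := by
  refine Finset.prod_bij' (fun i _ => (i : ZMod η)) (fun x _ => x.val) ?_ ?_ ?_ ?_ ?_
  · simp
  · intro x _; simpa using ZMod.val_lt x
  · intro i hi; exact ZMod.val_cast_of_lt (by simpa using hi)
  · intro x _; simp
  · simp

lemma aux_mul (η p : ℕ) [NeZero η] (D : Matrix (Fin p) (Fin p) ℂ) (c : ZMod η → ℂ)
    (v : ZMod η × Fin p → ℂ) (j : ZMod η) (a : Fin p) :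
    (Matrix.of fun x y : ZMod η × Fin p =>
        -(if x.1 = y.1 then D x.2 y.2 else 0)
          + (if x.1 = y.1 + 1 then c y.1 else 0) * (if x.2 = y.2 then 1 else 0)).mulVec v (j+1, a)
      = - (D.mulVec fun b => v (j+1, b)) a + c j * v (j, a) := by
  simp only [Matrix.mulVec, dotProduct, Matrix.of_apply, Fintype.sum_prod_type, add_mul,
    Finset.sum_add_distrib]
  congr 1
  · rw [Finset.sum_eq_single (j+1)]
    · simp
    · intro b _ hb
      simp [hb.symm]
    · simp
  · rw [Finset.sum_eq_single j]
    · simp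
    · intro b _ hb
      have : j ≠ b := hb.symm
      simp [this]
    · simp

lemma aux_ker (η p : ℕ) [NeZero η] (D : Matrix (Fin p) (Fin p) ℂ) (c : ZMod η → ℂ)
    (v : ZMod η × Fin p → ℂ) :
    (Matrix.of fun x y : ZMod η × Fin p =>
        -(if x.1 = y.1 then D x.2 y.2 else 0)
          + (if x.1 = y.1 + 1 then c y.1 else 0) * (if x.2 = y.2 then 1 else 0)).mulVec v = 0
      ↔ ∀ j, (D.mulVec fun b => v (j+1, b)) = c j • fun b => v (j, b) := by
  constructor
  · intro h j
    ext a
    have := congrFun h (j+1, a)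
    rw [aux_mul] at this
    simp only [Pi.zero_apply, Pi.smul_apply, smul_eq_mul] at this ⊢
    linear_combination -this
  · intro h
    ext ⟨i, a⟩
    obtain ⟨j, rfl⟩ : ∃ j, i = j + 1 := ⟨i - 1, by ring⟩
    rw [aux_mul, h j]
    simp

/-- The `(ηp)×(ηp)` block matrix with blocks `-D` on the diagonal and
`c_j · Id_p` in block position `(j+1 mod η, j)` is invertible if and only if
`∏_j c_j` is not an eigenvalue of `D^η`. -/
theorem stmt_10 (η p : ℕ) [NeZero η] (hp : 1 ≤ p)
    (D : Matrix (Fin p) (Fin p) ℂ) (hD : D.det ≠ 0)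
    (c : ZMod η → ℂ) (hc : ∀ j, c j ≠ 0) :
    (Matrix.of fun x y : ZMod η × Fin p =>
        -(if x.1 = y.1 then D x.2 y.2 else 0)
          + (if x.1 = y.1 + 1 then c y.1 else 0) * (if x.2 = y.2 then 1 else 0)).det ≠ 0
      ↔ (D ^ η - (∏ j : ZMod η, c j) • (1 : Matrix (Fin p) (Fin p) ℂ)).det ≠ 0 := by
  refine not_congr ?_
  rw [← Matrix.exists_mulVec_eq_zero_iff, ← Matrix.exists_mulVec_eq_zero_iff]
  simp only [aux_ker, Matrix.sub_mulVec, Matrix.smul_mulVec, Matrix.one_mulVec, sub_eq_zero]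
  constructor
  · rintro ⟨v, hv, h⟩
    have key : ∀ (k : ℕ) (j : ZMod η), ((D ^ k).mulVec fun b => v (j + k, b))
        = (∏ i ∈ Finset.range k, c (j + i)) • fun b => v (j, b) := by
      intro k
      induction k with
      | zero => intro j; simp
      | succ k ih =>
        intro j
        have h1 := h (j + k)
        rw [pow_succ, ← Matrix.mulVec_mulVec, Nat.cast_succ, ← add_assoc, h1, Matrix.mulVec_smul,
          ih, Finset.prod_range_succ, smul_smul, mul_comm]
    obtain ⟨⟨j, a⟩, hja⟩ := Function.ne_iff.mp hv
    refine ⟨fun b => v (j, b), fun h0 => hja (congrFun h0 a), ?_⟩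
    have h2 := key η j
    rw [aux_prod η (fun x => c (j + x)), Fintype.prod_equiv (Equiv.addLeft j) (fun x => c (j + x)) c
      (fun x => rfl)] at h2
    simpa using h2
  · rintro ⟨w, hw, h⟩
    have hu : IsUnit D.det := isUnit_iff_ne_zero.mpr hD
    let u : ℕ → Fin p → ℂ := fun k =>
      (∏ i ∈ Finset.range k, c (i : ZMod η)) • (D⁻¹ ^ k).mulVec w
    have hstep : ∀ k, D.mulVec (u (k+1)) = c (k : ZMod η) • u k := by
      intro k
      simp only [u]
      rw [Matrix.mulVec_smul, Matrix.mulVec_mulVec, pow_succ', ← mul_assoc,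
        Matrix.mul_nonsing_inv _ hu, one_mul, Finset.prod_range_succ, smul_smul, mul_comm]
    have hper : u η = u 0 := by
      simp only [u]
      rw [aux_prod η c, ← Matrix.mulVec_smul, ← h, Matrix.mulVec_mulVec, Matrix.inv_pow',
        Matrix.nonsing_inv_mul _ (by rw [Matrix.det_pow]; exact hu.pow _)]
      simp
    refine ⟨fun x => u x.1.val x.2, fun h0 => hw ?_, ?_⟩
    · ext a
      have := congrFun h0 (0, a)
      simpa [u] using this
    · intro j
      have hv : u (j+1).val = u (j.val+1) := by
        have h3 : (j+1).val = (j.val + 1) % η := by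
          rw [← ZMod.val_natCast]; simp
        rcases Nat.lt_or_ge (j.val+1) η with hl | hl
        · rw [h3, Nat.mod_eq_of_lt hl]
        · have : j.val + 1 = η := le_antisymm (ZMod.val_lt j) hl
          rw [h3, this, Nat.mod_self, hper]
      have := hstep j.val
      rw [ZMod.natCast_zmod_val, ← hv] at this
      exact this
end

section
/- Let d ≥ 1, let ‖·‖ denote the Euclidean norm on ℂ^d, and let R > 0, M > 0, 0 < Λ < 1, N ∈ ℕ, and μ ∈ ℂ with Λ^N < |μ|. Suppose f : ℂ^d → ℂ^d satisfies ‖f^{∘n}(x)‖ ≤ Λ^n ‖x‖ for every n ∈ ℕ and every x with ‖x‖ ≤ R, and ρ : ℂ^d → ℂ satisfies |ρ(x)| ≤ M ‖x‖^N for every x with ‖x‖ ≤ R. Then for every x with ‖x‖ ≤ R the series φ(x) := ∑_{n=1}^∞ μ^{−n} ρ(f^{∘(n−1)}(x)) converges absolutely, satisfies |φ(x)| ≤ (M/(|μ| − Λ^N)) ‖x‖^N, and the functional equation ρ(x) + φ(f(x)) = μ φ(x) holds for every x with ‖x‖ ≤ R. -/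
/-- If `‖f^[n] x‖ ≤ Λ^n ‖x‖`, `|ρ(x)| ≤ M ‖x‖^N` for `‖x‖ ≤ R` and `Λ^N < |μ|`,
then `φ(x) = ∑_{n≥1} μ^{-n} ρ(f^[n-1] x)` converges absolutely, satisfies
`|φ(x)| ≤ (M/(|μ|-Λ^N)) ‖x‖^N` and the functional equation
`ρ(x) + φ(f(x)) = μ φ(x)`. -/
theorem stmt_12 (d : ℕ) (hd : 1 ≤ d)
    (R M Λ : ℝ) (N : ℕ) (μ : ℂ)
    (hR : 0 < R) (hM : 0 < M) (hΛ0 : 0 < Λ) (hΛ1 : Λ < 1) (hμ : Λ ^ N < ‖μ‖)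
    (f : EuclideanSpace ℂ (Fin d) → EuclideanSpace ℂ (Fin d))
    (ρ : EuclideanSpace ℂ (Fin d) → ℂ)
    (hf : ∀ (n : ℕ) x, ‖x‖ ≤ R → ‖f^[n] x‖ ≤ Λ ^ n * ‖x‖)
    (hρ : ∀ x, ‖x‖ ≤ R → ‖ρ x‖ ≤ M * ‖x‖ ^ N) :
    ∀ x, ‖x‖ ≤ R →
      Summable (fun n : ℕ => ‖μ⁻¹ ^ (n + 1) * ρ (f^[n] x)‖) ∧
      ‖∑' n : ℕ, μ⁻¹ ^ (n + 1) * ρ (f^[n] x)‖ ≤ M / (‖μ‖ - Λ ^ N) * ‖x‖ ^ N ∧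
      ρ x + (∑' n : ℕ, μ⁻¹ ^ (n + 1) * ρ (f^[n] (f x)))
        = μ * ∑' n : ℕ, μ⁻¹ ^ (n + 1) * ρ (f^[n] x) := by
  intro x hx
  have hΛN : 0 < Λ ^ N := pow_pos hΛ0 N
  have hμ0 : 0 < ‖μ‖ := hΛN.trans hμ
  have hμne : μ ≠ 0 := norm_pos_iff.mp hμ0
  have hr0 : 0 ≤ Λ ^ N / ‖μ‖ := by positivity
  have hr1 : Λ ^ N / ‖μ‖ < 1 := (div_lt_one hμ0).mpr hμ
  have key : ∀ n : ℕ, ‖μ⁻¹ ^ (n + 1) * ρ (f^[n] x)‖ ≤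
      (M * ‖x‖ ^ N / ‖μ‖) * (Λ ^ N / ‖μ‖) ^ n := by
    intro n
    have h1 := hf n x hx
    have h2 : ‖f^[n] x‖ ≤ R := by
      refine h1.trans (le_trans ?_ hx)
      exact mul_le_of_le_one_left (norm_nonneg x) (pow_le_one₀ hΛ0.le hΛ1.le)
    have h3 : ‖ρ (f^[n] x)‖ ≤ M * (Λ ^ n * ‖x‖) ^ N :=
      (hρ _ h2).trans (by gcongr)
    rw [norm_mul, norm_pow, norm_inv]
    calc ‖μ‖⁻¹ ^ (n + 1) * ‖ρ (f^[n] x)‖ ≤ ‖μ‖⁻¹ ^ (n + 1) * (M * (Λ ^ n * ‖x‖) ^ N) := by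
          gcongr
      _ = _ := by
          rw [mul_pow, ← pow_mul, mul_comm n N, pow_mul, div_pow, inv_pow]
          field_simp
          ring
  have hg : HasSum (fun n : ℕ => (M * ‖x‖ ^ N / ‖μ‖) * (Λ ^ N / ‖μ‖) ^ n)
      ((M * ‖x‖ ^ N / ‖μ‖) * (1 - Λ ^ N / ‖μ‖)⁻¹) :=
    (hasSum_geometric_of_lt_one hr0 hr1).mul_left _
  have hs : Summable (fun n : ℕ => ‖μ⁻¹ ^ (n + 1) * ρ (f^[n] x)‖) :=
    Summable.of_nonneg_of_le (fun _ => norm_nonneg _) key hg.summable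
  refine ⟨hs, ?_, ?_⟩
  · refine (tsum_of_norm_bounded hg key).trans (le_of_eq ?_)
    have h4 : ‖μ‖ - Λ ^ N ≠ 0 := (sub_pos.mpr hμ).ne'
    have h5 : 1 - Λ ^ N / ‖μ‖ = (‖μ‖ - Λ ^ N) / ‖μ‖ := by
      field_simp
    rw [h5, inv_div]
    field_simp
  · rw [hs.of_norm.tsum_eq_zero_add, mul_add, ← tsum_mul_left]
    congr 1
    · simp [hμne]
    · refine tsum_congr fun n => ?_
      rw [Function.iterate_succ_apply, pow_succ μ⁻¹ (n + 1)]
      field_simp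
end

section
/- Let r ∈ ℕ, e ≥ 1, and let η ≥ 1 be an integer. Let ξ ∈ ℂ^r with 0 < |ξ_l| < 1 for every l, and let μ ∈ ℂ^e with 1 > |μ_1| ≥ |μ_2| ≥ … ≥ |μ_e| > 0. Fix k ∈ {1,…,e} and suppose (n_u, n_v) ∈ ℕ^r × ℕ^e satisfies ξ^{n_u} μ^{η n_v} = μ_k^η. Then either (n_v)_l = 0 for every l ≥ k, or n_u = 0 and n_v = e^l is a standard basis vector for some l ∈ {1,…,e} (in which case μ_l^η = μ_k^η). -/
/-- With `1 > |μ_1| ≥ … ≥ |μ_e| > 0`, if `ξ^{n_u} μ^{η n_v} = μ_k^η` then either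
`(n_v)_l = 0` for every `l ≥ k`, or `n_u = 0` and `n_v` is a standard basis
vector `e^l` (in which case `μ_l^η = μ_k^η`). -/
theorem stmt_14 (r e η : ℕ) (he : 1 ≤ e) (hη : 1 ≤ η)
    (ξ : Fin r → ℂ) (μ : Fin e → ℂ)
    (hξ : ∀ l, 0 < ‖ξ l‖ ∧ ‖ξ l‖ < 1)
    (hμ : ∀ j, 0 < ‖μ j‖ ∧ ‖μ j‖ < 1)
    (hμmono : ∀ i j : Fin e, i ≤ j → ‖μ j‖ ≤ ‖μ i‖)
    (k : Fin e) (nu : Fin r → ℕ) (nv : Fin e → ℕ)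
    (hres : (∏ l, ξ l ^ nu l) * (∏ j, μ j ^ (η * nv j)) = μ k ^ η) :
    (∀ l : Fin e, k ≤ l → nv l = 0) ∨
      (nu = 0 ∧ ∃ l : Fin e,
        nv = (fun i => if i = l then 1 else 0) ∧ μ l ^ η = μ k ^ η) := by
  by_cases h0 : ∀ l : Fin e, k ≤ l → nv l = 0
  · exact Or.inl h0
  right
  push Not at h0
  obtain ⟨l, hkl, hl⟩ := h0
  have hη0 : (0 : ℝ) < η := by exact_mod_cast hη
  have ha : ∀ i, 0 < -Real.log ‖ξ i‖ := fun i => by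
    have := Real.log_neg (hξ i).1 (hξ i).2
    linarith
  have hb : ∀ i, 0 < -Real.log ‖μ i‖ := fun i => by
    have := Real.log_neg (hμ i).1 (hμ i).2
    linarith
  have hlk : Real.log ‖μ l‖ ≤ Real.log ‖μ k‖ := Real.log_le_log (hμ l).1 (hμmono k l hkl)
  have hlog : (∑ i, (nu i : ℝ) * Real.log ‖ξ i‖) + ∑ j, ((η * nv j : ℕ) : ℝ) * Real.log ‖μ j‖
      = η * Real.log ‖μ k‖ := by
    have h1 := congrArg (fun z : ℂ => Real.log ‖z‖) hres
    simp only [norm_mul, norm_prod, norm_pow] at h1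
    rw [Real.log_mul (Finset.prod_ne_zero_iff.2 fun i _ => pow_ne_zero _ (hξ i).1.ne')
      (Finset.prod_ne_zero_iff.2 fun i _ => pow_ne_zero _ (hμ i).1.ne'),
      Real.log_prod (fun i _ => pow_ne_zero _ (hξ i).1.ne'),
      Real.log_prod (fun i _ => pow_ne_zero _ (hμ i).1.ne')] at h1
    simpa only [Real.log_pow] using h1
  obtain ⟨m, hm⟩ : ∃ m : Fin e → ℕ, ∀ i, nv i = m i + if i = l then 1 else 0 := by
    refine ⟨fun i => nv i - if i = l then 1 else 0, fun i => ?_⟩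
    by_cases hi : i = l
    · subst hi
      simp
      omega
    · simp [hi]
  have hsplit : ∑ j, ((η * nv j : ℕ) : ℝ) * Real.log ‖μ j‖
      = -(η * ∑ j, (m j : ℝ) * (-Real.log ‖μ j‖)) + η * Real.log ‖μ l‖ := by
    have : ∀ j, ((η * nv j : ℕ) : ℝ) * Real.log ‖μ j‖ =
        -(η * ((m j : ℝ) * (-Real.log ‖μ j‖))) + if j = l then η * Real.log ‖μ j‖ else 0 := by
      intro j
      rw [hm j]
      split_ifs <;> push_cast <;> ring
    rw [Finset.sum_congr rfl fun j _ => this j, Finset.sum_add_distrib, Finset.sum_neg_distrib,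
      Finset.mul_sum]
    simp
  have hA : ∀ i ∈ Finset.univ, 0 ≤ (nu i : ℝ) * (-Real.log ‖ξ i‖) := fun i _ =>
    mul_nonneg (Nat.cast_nonneg _) (ha i).le
  have hB : ∀ i ∈ Finset.univ, 0 ≤ (m i : ℝ) * (-Real.log ‖μ i‖) := fun i _ =>
    mul_nonneg (Nat.cast_nonneg _) (hb i).le
  have hSA := Finset.sum_nonneg hA
  have hSB := Finset.sum_nonneg hB
  have hneg : ∑ i, (nu i : ℝ) * (-Real.log ‖ξ i‖) = -∑ i, (nu i : ℝ) * Real.log ‖ξ i‖ := by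
    simp
  have hSB' := mul_nonneg hη0.le hSB
  have hk' := mul_le_mul_of_nonneg_left hlk hη0.le
  have hA0 : ∑ i, (nu i : ℝ) * (-Real.log ‖ξ i‖) = 0 := by linarith
  have hB0 : (η : ℝ) * ∑ i, (m i : ℝ) * (-Real.log ‖μ i‖) = 0 := by linarith
  have hB1 := (mul_eq_zero.1 hB0).resolve_left hη0.ne'
  have hnu : nu = 0 := by
    funext i
    have := (Finset.sum_eq_zero_iff_of_nonneg hA).1 hA0 i (Finset.mem_univ i)
    exact_mod_cast (mul_eq_zero.1 this).resolve_right (ha i).ne'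
  have hnv : nv = fun i => if i = l then 1 else 0 := by
    funext i
    have := (Finset.sum_eq_zero_iff_of_nonneg hB).1 hB1 i (Finset.mem_univ i)
    have h2 : m i = 0 := by exact_mod_cast (mul_eq_zero.1 this).resolve_right (hb i).ne'
    rw [hm i, h2, zero_add]
  refine ⟨hnu, l, hnv, ?_⟩
  rw [← hres, hnu, hnv]
  simp [mul_ite, pow_ite]
end

section
/- Let m ≥ 1 and a ≥ 1 be integers, λ ∈ ℂ*, U ⊆ ℂ an open neighborhood of 0, and ψ, ξ : U → ℂ holomorphic functions with ψ(0) = 0 and ψ′(z) = m z^{m−1} ξ(z) for all z ∈ U. Define f : ℂ × ℂ × U → ℂ³ by f(X, Y, Z) = (λ X^a, X Y + Z^m, X Z + X Y ξ(Z) + ψ(Z)). Then f is holomorphic, and for every (X, Y, Z) ∈ ℂ × ℂ × U the determinant of the complex differential of f at (X, Y, Z) equals λ a X^{a+1} (1 + Y ξ′(Z)). Moreover f(0, Y, Z) = (0, Z^m, ψ(Z)) for all (Y, Z) ∈ ℂ × U, so f maps the plane {X = 0} onto {0} × Ψ(U), where Ψ : U → ℂ² is the curve parametrization Ψ(T) =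 (T^m, ψ(T)). -/
def cubeEquiv : (ℂ × ℂ × ℂ) ≃ₗ[ℂ] (Fin 3 → ℂ) where
  toFun w := ![w.1, w.2.1, w.2.2]
  invFun v := (v 0, v 1, v 2)
  map_add' x y := by ext i; fin_cases i <;> simp
  map_smul' c x := by ext i; fin_cases i <;> simp
  left_inv x := by simp
  right_inv v := by ext i; fin_cases i <;> simp

theorem det_cube (L : (ℂ × ℂ × ℂ) →ₗ[ℂ] (ℂ × ℂ × ℂ)) (p q r s t u v w x : ℂ)
    (h : ∀ X Y Z, L (X, Y, Z) = (p * X + q * Y + r * Z, s * X + t * Y + u * Z,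
      v * X + w * Y + x * Z)) :
    LinearMap.det L = p * t * x - p * u * w - q * s * x + q * u * v + r * s * w - r * t * v := by
  rw [← LinearMap.det_toMatrix (Module.Basis.ofEquivFun cubeEquiv), Matrix.det_fin_three]
  simp [LinearMap.toMatrix_apply, cubeEquiv, h]

/-- The example `f(X,Y,Z) = (λ X^a, XY + Z^m, XZ + XY ξ(Z) + ψ(Z))` with
`ψ'(z) = m z^{m-1} ξ(z)`: `f` is holomorphic where `Z ∈ U`, its Jacobian
determinant is `λ a X^{a+1} (1 + Y ξ'(Z))`, and `f` maps the plane `{X = 0}`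
onto `{0} × Ψ(U)` where `Ψ(T) = (T^m, ψ(T))`. -/
theorem stmt_17 (m a : ℕ) (hm : 1 ≤ m) (ha : 1 ≤ a)
    (lam : ℂ) (hlam : lam ≠ 0)
    (U : Set ℂ) (hU : IsOpen U) (h0U : (0 : ℂ) ∈ U)
    (ψ ξ : ℂ → ℂ)
    (hψ : DifferentiableOn ℂ ψ U) (hξ : DifferentiableOn ℂ ξ U)
    (hψ0 : ψ 0 = 0)
    (hψ' : ∀ z ∈ U, deriv ψ z = (m : ℂ) * z ^ (m - 1) * ξ z)
    (f : ℂ × ℂ × ℂ → ℂ × ℂ × ℂ)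
    (hf : ∀ X Y Z : ℂ, f (X, Y, Z) =
      (lam * X ^ a, X * Y + Z ^ m, X * Z + X * Y * ξ Z + ψ Z)) :
    (∀ X Y Z : ℂ, Z ∈ U → DifferentiableAt ℂ f (X, Y, Z)) ∧
      (∀ X Y Z : ℂ, Z ∈ U →
        LinearMap.det (fderiv ℂ f (X, Y, Z)).toLinearMap
          = lam * (a : ℂ) * X ^ (a + 1) * (1 + Y * deriv ξ Z)) ∧
      (∀ Y Z : ℂ, Z ∈ U → f (0, Y, Z) = (0, Z ^ m, ψ Z)) ∧
      f '' {w : ℂ × ℂ × ℂ | w.1 = 0 ∧ w.2.2 ∈ U}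
        = {w : ℂ × ℂ × ℂ | ∃ T ∈ U, w = (0, T ^ m, ψ T)} := by
  have key : ∀ X Y Z : ℂ, Z ∈ U → ∃ L : (ℂ × ℂ × ℂ) →L[ℂ] (ℂ × ℂ × ℂ),
      HasFDerivAt f L (X, Y, Z) ∧ ∀ A B C, L (A, B, C) =
        ((lam * (a * X ^ (a - 1))) * A + 0 * B + 0 * C,
          Y * A + X * B + (m * Z ^ (m - 1)) * C,
          (Z + Y * ξ Z) * A + (X * ξ Z) * B + (X + X * Y * deriv ξ Z + deriv ψ Z) * C) := by
    intro X Y Z hZ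
    have hfe : f = fun w : ℂ × ℂ × ℂ => (lam * w.1 ^ a, w.1 * w.2.1 + w.2.2 ^ m,
        w.1 * w.2.2 + w.1 * w.2.1 * ξ w.2.2 + ψ w.2.2) := by
      funext ⟨x, y, z⟩
      exact hf x y z
    have hx : HasFDerivAt (fun w : ℂ × ℂ × ℂ => w.1) (ContinuousLinearMap.fst ℂ ℂ (ℂ × ℂ))
        (X, Y, Z) := hasFDerivAt_fst
    have hyz : HasFDerivAt (fun w : ℂ × ℂ × ℂ => w.2) (ContinuousLinearMap.snd ℂ ℂ (ℂ × ℂ))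
        (X, Y, Z) := hasFDerivAt_snd
    have hy := hyz.fst
    have hz := hyz.snd
    have h1 : HasDerivAt ξ (deriv ξ Z) Z :=
      (hξ.differentiableAt (hU.mem_nhds hZ)).hasDerivAt
    have h2 : HasDerivAt ψ (deriv ψ Z) Z :=
      (hψ.differentiableAt (hU.mem_nhds hZ)).hasDerivAt
    have h3 := HasDerivAt.comp_hasFDerivAt (f := fun w : ℂ × ℂ × ℂ => w.2.2) (X, Y, Z) h1 hz
    have h4 := HasDerivAt.comp_hasFDerivAt (f := fun w : ℂ × ℂ × ℂ => w.2.2) (X, Y, Z) h2 hz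
    have h5 := HasDerivAt.comp_hasFDerivAt (f := fun w : ℂ × ℂ × ℂ => w.2.2) (X, Y, Z)
      (hasDerivAt_pow m Z) hz
    have h6 := HasDerivAt.comp_hasFDerivAt (f := fun w : ℂ × ℂ × ℂ => w.1) (X, Y, Z)
      (hasDerivAt_pow a X) hx
    have hF := (h6.const_mul lam).prodMk (((hx.mul hy).add h5).prodMk
      (((hx.mul hz).add ((hx.mul hy).mul h3)).add h4))
    refine ⟨_, hfe ▸ hF, ?_⟩
    intro A B C
    simp
    refine ⟨?_, ?_, ?_⟩ <;> ring
  refine ⟨?_, ?_, ?_, ?_⟩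
  · intro X Y Z hZ
    obtain ⟨L, hL, -⟩ := key X Y Z hZ
    exact hL.differentiableAt
  · intro X Y Z hZ
    obtain ⟨L, hL, h⟩ := key X Y Z hZ
    rw [hL.fderiv, det_cube _ _ _ _ _ _ _ _ _ _ h, hψ' Z hZ]
    obtain ⟨k, rfl⟩ := Nat.exists_eq_add_of_le' ha
    simp only [Nat.add_sub_cancel]
    ring
  · intro Y Z hZ
    rw [hf]
    simp [show a ≠ 0 by omega]
  · ext w
    constructor
    · rintro ⟨⟨x, y, z⟩, ⟨hx, hz⟩, rfl⟩
      simp only at hx hz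
      subst hx
      exact ⟨z, hz, by rw [hf]; simp [show a ≠ 0 by omega]⟩
    · rintro ⟨T, hT, rfl⟩
      exact ⟨(0, 0, T), ⟨rfl, hT⟩, by rw [hf]; simp [show a ≠ 0 by omega]⟩
end
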